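/- arXiv:2004.03652 — 2 statements merged into one kernel-verified Lean document; each statement's English description precedes it below -/
import Mathlib

section
/- Let φ satisfy assumptions (A1)–(A2) with α ∈ (0,2) and a₀ ≤ 1/2, and let (ρ,u) be a smooth solution of the Euler-alignment system on ℝ×[0,T], 1-periodic in x, with min_{𝕋} ρ₀ > 0. Then for all x ∈ ℝ and t ∈ [0,T], ρ(x,t) ≥ M₀ e^{−c₃ ρ̄₀ t}, where M₀ := c₃ρ̄₀ / ( c₃ρ̄₀ (min_{𝕋} ρ₀)^{−1} + ‖F₀‖_{L^∞} ) > 0. In particular no vacuum forms in finite time. -/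
open Real MeasureTheory Filter Set Topology

noncomputable section

/-- Principal-value Lévy operator: (𝓛 f)(x) = p.v. ∫ φ(x-y)(f(x)-f(y)) dy. -/
def levy (φ f : ℝ → ℝ) (x : ℝ) : ℝ :=
  limUnder (nhdsWithin (0:ℝ) (Set.Ioi 0))
    (fun ε => ∫ y in {y : ℝ | ε ≤ |x - y|}, φ (x - y) * (f x - f y))

/-- Principal-value alignment force. -/
def alignForce (φ ρ u : ℝ → ℝ) (x : ℝ) : ℝ :=
  limUnder (nhdsWithin (0:ℝ) (Set.Ioi 0))
    (fun ε => ∫ y in {y : ℝ | ε ≤ |x - y|}, φ (x - y) * (u y - u x) * ρ y)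

/-- Periodization -/
def phiS (φ : ℝ → ℝ) (x : ℝ) : ℝ := ∑' k : ℤ, φ (x + (k : ℝ))

def supNorm (f : ℝ → ℝ) : ℝ := ⨆ x : ℝ, |f x|

structure A12 (φ : ℝ → ℝ) (α a₀ c₁ c₂ : ℝ) : Prop where
  αpos : 0 < α
  αlt : α < 2
  a₀pos : 0 < a₀
  a₀le : a₀ ≤ 1/2
  c₁ge : 1 ≤ c₁
  c₂pos : 0 < c₂
  even : ∀ x : ℝ, φ (-x) = φ x
  smooth : ContDiffOn ℝ 4 φ {(0:ℝ)}ᶜ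
  lower : ∀ x : ℝ, x ≠ 0 → |x| ≤ a₀ → c₁⁻¹ * |x| ^ (-(1+α)) ≤ φ x
  upper : ∀ x : ℝ, x ≠ 0 → |x| ≤ a₀ → φ x ≤ c₁ * |x| ^ (-(1+α))
  derivBound : ∀ j : ℕ, 1 ≤ j → j ≤ 4 → ∀ x : ℝ, x ≠ 0 → |x| ≤ a₀ →
    |iteratedDeriv j φ x| ≤ c₁ * |x| ^ (-(1+(j:ℝ)+α))
  mono : ∀ r s : ℝ, 0 < r → r ≤ s → s ≤ a₀ → φ s ≤ φ r
  tailInt : ∀ j : ℕ, j ≤ 4 →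
    IntegrableOn (fun x : ℝ => |x| ^ (j:ℝ) * |iteratedDeriv j φ x|) {x : ℝ | a₀ ≤ |x|}
  tailBound : ∀ j : ℕ, j ≤ 4 →
    (∫ x in {x : ℝ | a₀ ≤ |x|}, |x| ^ (j:ℝ) * |iteratedDeriv j φ x|) ≤ c₂

structure EASol (φ : ℝ → ℝ) (T : ℝ) (ρ u : ℝ → ℝ → ℝ) : Prop where
  smooth_rho : ContDiffOn ℝ (⊤ : ℕ∞) (Function.uncurry ρ) (Set.univ ×ˢ Set.Icc 0 T)
  smooth_u : ContDiffOn ℝ (⊤ : ℕ∞) (Function.uncurry u) (Set.univ ×ˢ Set.Icc 0 T)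
  periodic_rho : ∀ x t, ρ (x + 1) t = ρ x t
  periodic_u : ∀ x t, u (x + 1) t = u x t
  mass : ∀ x : ℝ, ∀ t ∈ Set.Icc 0 T,
    derivWithin (fun s => ρ x s) (Set.Icc 0 T) t + deriv (fun y => ρ y t * u y t) x = 0
  mom : ∀ x : ℝ, ∀ t ∈ Set.Icc 0 T,
    derivWithin (fun s => u x s) (Set.Icc 0 T) t + u x t * deriv (fun y => u y t) x
      = alignForce φ (fun y => ρ y t) (fun y => u y t) x

/-- The second symmetric difference `2 f(x) - f(x+z) - f(x-z)`. -/
def symDiff₂ (f : ℝ → ℝ) (x z : ℝ) : ℝ := 2 * f x - f (x + z) - f (x - z)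

/-- The absolutely convergent, symmetrized form of the Lévy operator. -/
def levySym (φ f : ℝ → ℝ) (x : ℝ) : ℝ := ∫ z in Ioi (0:ℝ), φ z * symDiff₂ f x z

/-- The weight dominating the kernel against second differences. -/
def kernelWeight (φ : ℝ → ℝ) (z : ℝ) : ℝ := |φ z| * min 1 (z ^ 2)

/-- `f` is twice differentiable with derivatives `f₁`, `f₂`, and `f`, `f₂` are bounded by `C`. -/
structure BddTwice (C : ℝ) (f f₁ f₂ : ℝ → ℝ) : Prop where
  deriv₁ : ∀ x, HasDerivAt f (f₁ x) x
  deriv₂ : ∀ x, HasDerivAt f₁ (f₂ x) x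
  bdd : ∀ x, |f x| ≤ C
  bdd₂ : ∀ x, |f₂ x| ≤ C

theorem setOf_le_abs_eq (ε : ℝ) : {z : ℝ | ε ≤ |z|} = Ici ε ∪ Iic (-ε) := by
  ext z
  simp only [mem_ofPred_eq, le_abs, mem_union, mem_Ici, mem_Iic]
  constructor <;> rintro (h | h) <;> first | (left; linarith) | (right; linarith)

theorem integrableOn_Iic_of_comp_neg {K : ℝ → ℝ} {ε : ℝ}
    (hK : IntegrableOn (fun z => K (-z)) (Ioi ε)) : IntegrableOn K (Iic (-ε)) := by
  have := (integrableOn_Ici_iff_integrableOn_Ioi (f := fun z => K (-z)) (μ := volume)).2 hK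
  have h2 := IntegrableOn.comp_neg this
  simpa using h2

theorem integral_abs_ge {K : ℝ → ℝ} {ε : ℝ} (hε : 0 < ε) (hK : IntegrableOn K (Ioi ε))
    (hK' : IntegrableOn (fun z => K (-z)) (Ioi ε)) :
    ∫ z in {z : ℝ | ε ≤ |z|}, K z = ∫ z in Ioi ε, (K z + K (-z)) := by
  rw [setOf_le_abs_eq ε, setIntegral_union _ measurableSet_Iic
    ((integrableOn_Ici_iff_integrableOn_Ioi enorm_ne_top).2 hK) (integrableOn_Iic_of_comp_neg hK'),
    integral_Ici_eq_integral_Ioi, integral_add hK hK', integral_comp_neg_Ioi]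
  rw [Set.disjoint_left]
  intro z hz hz'
  simp only [mem_Ici, mem_Iic] at hz hz'
  linarith

theorem A12.continuousOn_Ioi {φ : ℝ → ℝ} {α a₀ c₁ c₂ : ℝ} (h : A12 φ α a₀ c₁ c₂) :
    ContinuousOn φ (Ioi 0) :=
  h.smooth.continuousOn.mono fun x hx => by simpa using (ne_of_gt hx)

theorem A12.hasDerivAt {φ : ℝ → ℝ} {α a₀ c₁ c₂ : ℝ} (h : A12 φ α a₀ c₁ c₂) {x : ℝ} (hx : 0 < x) :
    HasDerivAt φ (deriv φ x) x :=
  ((h.smooth.contDiffAt (isOpen_compl_singleton.mem_nhds (by simpa using hx.ne'))).differentiableAt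
    (by norm_num)).hasDerivAt

theorem A12.continuousOn_deriv {φ : ℝ → ℝ} {α a₀ c₁ c₂ : ℝ} (h : A12 φ α a₀ c₁ c₂) :
    ContinuousOn (deriv φ) (Ioi 0) :=
  (h.smooth.continuousOn_deriv_of_isOpen isOpen_compl_singleton (by norm_num)).mono
    fun x hx => by simpa using (ne_of_gt hx)

theorem A12.nonneg {φ : ℝ → ℝ} {α a₀ c₁ c₂ : ℝ} (h : A12 φ α a₀ c₁ c₂) {x : ℝ} (hx : 0 < x)
    (hxa : x ≤ a₀) : 0 ≤ φ x := by
  refine le_trans ?_ (h.lower x hx.ne' (by rwa [abs_of_pos hx]))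
  have := h.c₁ge
  positivity

theorem A12.integrableOn_abs_tail {φ : ℝ → ℝ} {α a₀ c₁ c₂ : ℝ} (h : A12 φ α a₀ c₁ c₂) :
    IntegrableOn (fun x => |φ x|) (Ioi a₀) := by
  have := (h.tailInt 0 (by norm_num)).mono_set (s := Ioi a₀) (fun x hx => by
    simp only [mem_ofPred_eq]; exact (le_of_lt hx).trans (le_abs_self x))
  simpa using this

theorem A12.integrableOn_kernelWeight {φ : ℝ → ℝ} {α a₀ c₁ c₂ : ℝ} (h : A12 φ α a₀ c₁ c₂) :
    IntegrableOn (kernelWeight φ) (Ioi 0) := by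
  have ha := h.a₀pos
  have hc : ContinuousOn (kernelWeight φ) (Ioi 0) := by
    unfold kernelWeight
    exact h.continuousOn_Ioi.abs.mul (by fun_prop)
  rw [← Ioc_union_Ioi_eq_Ioi ha.le]
  refine IntegrableOn.union ?_ ?_
  · have h1 : IntegrableOn (fun x : ℝ => c₁ * x ^ (1 - α)) (Ioc 0 a₀) := by
      have := (intervalIntegral.intervalIntegrable_rpow' (a := 0) (b := a₀) (r := 1 - α)
        (by linarith [h.αlt])).const_mul c₁
      rwa [intervalIntegrable_iff_integrableOn_Ioc_of_le ha.le] at this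
    refine Integrable.mono' h1 ((hc.mono Ioc_subset_Ioi_self).aestronglyMeasurable
      measurableSet_Ioc) ?_
    refine (ae_restrict_iff' measurableSet_Ioc).2 (Eventually.of_forall fun x hx => ?_)
    have hx0 := hx.1
    have hφ := h.nonneg hx.1 hx.2
    have hu := h.upper x hx.1.ne' (by rw [abs_of_pos hx.1]; exact hx.2)
    rw [abs_of_pos hx.1] at hu
    have hw : 0 ≤ kernelWeight φ x := by unfold kernelWeight; positivity
    rw [Real.norm_of_nonneg hw]
    unfold kernelWeight
    rw [abs_of_nonneg hφ]
    calc φ x * min 1 (x ^ 2) ≤ φ x * x ^ 2 := by gcongr; exact min_le_right _ _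
      _ ≤ (c₁ * x ^ (-(1 + α))) * x ^ 2 := by gcongr
      _ = c₁ * x ^ (1 - α) := by
        rw [mul_assoc, ← Real.rpow_natCast x 2, ← Real.rpow_add hx.1]
        congr 2; push_cast; ring
  · refine Integrable.mono' h.integrableOn_abs_tail
      ((hc.mono (Ioi_subset_Ioi ha.le)).aestronglyMeasurable measurableSet_Ioi) ?_
    refine Eventually.of_forall fun x => ?_
    have hw : 0 ≤ kernelWeight φ x := by unfold kernelWeight; positivity
    rw [Real.norm_of_nonneg hw]
    unfold kernelWeight
    exact mul_le_of_le_one_right (abs_nonneg _) (min_le_left _ _)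

theorem A12.integrableOn_Ioi {φ : ℝ → ℝ} {α a₀ c₁ c₂ : ℝ} (h : A12 φ α a₀ c₁ c₂) {ε : ℝ}
    (hε : 0 < ε) : IntegrableOn φ (Ioi ε) := by
  have h1 : IntegrableOn (fun z => (min 1 (ε ^ 2))⁻¹ * kernelWeight φ z) (Ioi ε) :=
    (h.integrableOn_kernelWeight.mono_set (Ioi_subset_Ioi hε.le)).const_mul _
  refine Integrable.mono' h1 ((h.continuousOn_Ioi.mono
    (Ioi_subset_Ioi hε.le)).aestronglyMeasurable measurableSet_Ioi) ?_
  refine (ae_restrict_iff' measurableSet_Ioi).2 (Eventually.of_forall fun x hx => ?_)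
  have hm : 0 < min 1 (ε ^ 2) := by positivity
  have hx' : ε < x := hx
  rw [Real.norm_eq_abs, inv_mul_eq_div, le_div_iff₀ hm]
  unfold kernelWeight
  gcongr

theorem BddTwice.continuous {C : ℝ} {f f₁ f₂ : ℝ → ℝ} (hf : BddTwice C f f₁ f₂) : Continuous f :=
  continuous_iff_continuousAt.2 fun x => (hf.deriv₁ x).continuousAt

theorem symDiff₂_continuous {f : ℝ → ℝ} (hf : Continuous f) (x : ℝ) :
    Continuous (symDiff₂ f x) := by
  unfold symDiff₂; fun_prop

theorem BddTwice.abs_symDiff₂_le {C : ℝ} {f f₁ f₂ : ℝ → ℝ} (hf : BddTwice C f f₁ f₂) (x : ℝ)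
    {z : ℝ} (hz : 0 < z) : |symDiff₂ f x z| ≤ 4 * C * min 1 (z ^ 2) := by
  have hC : 0 ≤ C := (abs_nonneg _).trans (hf.bdd 0)
  have hL : ∀ a b, |f₁ b - f₁ a| ≤ C * |b - a| := fun a b => by
    have := convex_univ.norm_image_sub_le_of_norm_hasDerivWithin_le (f := f₁) (f' := f₂) (C := C)
      (fun x _ => (hf.deriv₂ x).hasDerivWithinAt) (fun x _ => hf.bdd₂ x) (mem_univ a) (mem_univ b)
    simpa using this
  have hd : ∀ s, HasDerivAt (symDiff₂ f x) (-f₁ (x + s) + f₁ (x - s)) s := fun s => by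
    have h1 := (hf.deriv₁ (x + s)).comp_const_add x s
    have h2 := (hf.deriv₁ (x - s)).comp_const_sub x s
    have := ((hasDerivAt_const s (2 * f x)).sub h1).sub h2
    refine this.congr_deriv (by ring)
  have h0 : symDiff₂ f x 0 = 0 := by simp [symDiff₂]; ring
  have hsq : |symDiff₂ f x z| ≤ (2 * C * z) * z := by
    have := (convex_Icc 0 z).norm_image_sub_le_of_norm_hasDerivWithin_le (f := symDiff₂ f x)
      (C := 2 * C * z) (fun s _ => (hd s).hasDerivWithinAt) (fun s hs => by
        have := hL (x + s) (x - s)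
        rw [Real.norm_eq_abs, neg_add_eq_sub]
        refine this.trans ?_
        have e : x - s - (x + s) = -(2 * s) := by ring
        rw [e, abs_neg, abs_of_nonneg (by linarith [hs.1])]
        nlinarith [hs.2]) (left_mem_Icc.2 hz.le) (right_mem_Icc.2 hz.le)
    simpa [h0, abs_of_pos hz] using this
  have hb : |symDiff₂ f x z| ≤ 4 * C := by
    unfold symDiff₂
    have h1 := abs_le.1 (hf.bdd x)
    have h2 := abs_le.1 (hf.bdd (x + z))
    have h3 := abs_le.1 (hf.bdd (x - z))
    rw [abs_le]; constructor <;> linarith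
  rcases le_total 1 (z ^ 2) with hz1 | hz1
  · rw [min_eq_left hz1]; linarith
  · rw [min_eq_right hz1]; nlinarith [mul_nonneg hC (sq_nonneg z)]

theorem BddTwice.abs_mul_symDiff₂_le {φ : ℝ → ℝ} {C : ℝ} {f f₁ f₂ : ℝ → ℝ}
    (hf : BddTwice C f f₁ f₂) (x : ℝ) {z : ℝ} (hz : 0 < z) :
    ‖φ z * symDiff₂ f x z‖ ≤ 4 * C * kernelWeight φ z := by
  rw [Real.norm_eq_abs, abs_mul]
  calc |φ z| * |symDiff₂ f x z| ≤ |φ z| * (4 * C * min 1 (z ^ 2)) := by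
        gcongr; exact hf.abs_symDiff₂_le x hz
    _ = 4 * C * kernelWeight φ z := by unfold kernelWeight; ring

theorem A12.aestronglyMeasurable_mul_symDiff₂ {φ : ℝ → ℝ} {α a₀ c₁ c₂ : ℝ}
    (h : A12 φ α a₀ c₁ c₂) {f : ℝ → ℝ} (hf : Continuous f) (x : ℝ) :
    AEStronglyMeasurable (fun z => φ z * symDiff₂ f x z) (volume.restrict (Ioi 0)) :=
  (h.continuousOn_Ioi.mul (symDiff₂_continuous hf x).continuousOn).aestronglyMeasurable
    measurableSet_Ioi

theorem A12.integrableOn_mul_symDiff₂ {φ : ℝ → ℝ} {α a₀ c₁ c₂ : ℝ} (h : A12 φ α a₀ c₁ c₂)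
    {C : ℝ} {f f₁ f₂ : ℝ → ℝ} (hf : BddTwice C f f₁ f₂) (x : ℝ) :
    IntegrableOn (fun z => φ z * symDiff₂ f x z) (Ioi 0) :=
  Integrable.mono' (h.integrableOn_kernelWeight.const_mul (4 * C))
    (h.aestronglyMeasurable_mul_symDiff₂ hf.continuous x)
    ((ae_restrict_iff' measurableSet_Ioi).2 (Eventually.of_forall fun _ hz =>
      hf.abs_mul_symDiff₂_le x hz))

/-- The truncated principal value integrals, folded onto the half-line. -/
theorem A12.truncated_eq {φ : ℝ → ℝ} {α a₀ c₁ c₂ : ℝ} (h : A12 φ α a₀ c₁ c₂) {f : ℝ → ℝ}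
    (hf : Continuous f) {C : ℝ} (hC : ∀ x, |f x| ≤ C) (x : ℝ) {ε : ℝ} (hε : 0 < ε) :
    IntegrableOn (fun y => φ (x - y) * (f x - f y)) {y : ℝ | ε ≤ |x - y|} ∧
    ∫ y in {y : ℝ | ε ≤ |x - y|}, φ (x - y) * (f x - f y) =
      ∫ z in Ioi ε, φ z * symDiff₂ f x z := by
  have hint : ∀ g : ℝ → ℝ, Continuous g → (∀ z, |g z| ≤ 2 * C) →
      IntegrableOn (fun z => φ z * g z) (Ioi ε) := fun g hg hgC =>
    Integrable.mul_bdd (c := 2 * C) (h.integrableOn_Ioi hε) hg.aestronglyMeasurable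
      (Eventually.of_forall hgC)
  have hb : ∀ a b, |f a - f b| ≤ 2 * C := fun a b => by
    have h1 := abs_le.1 (hC a)
    have h2 := abs_le.1 (hC b)
    rw [abs_le]; constructor <;> linarith
  have hK : IntegrableOn (fun z => φ z * (f x - f (x - z))) (Ioi ε) :=
    hint _ (by fun_prop) fun z => hb _ _
  have hK' : IntegrableOn (fun z => φ (-z) * (f x - f (x - -z))) (Ioi ε) := by
    simp only [h.even]
    exact hint _ (by fun_prop) fun z => hb _ _
  have hm : MeasurableSet {z : ℝ | ε ≤ |z|} := measurableSet_le measurable_const measurable_norm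
  have hm' : MeasurableSet {y : ℝ | ε ≤ |x - y|} :=
    measurableSet_le measurable_const (by fun_prop)
  have hind : ({y : ℝ | ε ≤ |x - y|}.indicator fun y => φ (x - y) * (f x - f y)) =
      fun y => {z : ℝ | ε ≤ |z|}.indicator (fun z => φ z * (f x - f (x - z))) (x - y) := by
    ext y
    by_cases hy : ε ≤ |x - y| <;> simp [indicator, hy]
  have hset : IntegrableOn (fun z => φ z * (f x - f (x - z))) {z : ℝ | ε ≤ |z|} := by
    rw [setOf_le_abs_eq ε]
    exact ((integrableOn_Ici_iff_integrableOn_Ioi enorm_ne_top).2 hK).union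
      (integrableOn_Iic_of_comp_neg (K := fun z => φ z * (f x - f (x - z))) hK')
  constructor
  · rw [← integrable_indicator_iff hm', hind]
    exact ((integrable_indicator_iff hm).2 hset).comp_sub_left x
  · rw [← integral_indicator hm', hind, integral_sub_left_eq_self
      (fun z => {z : ℝ | ε ≤ |z|}.indicator (fun z => φ z * (f x - f (x - z))) z),
      integral_indicator hm, integral_abs_ge hε hK hK']
    refine integral_congr_ae (Eventually.of_forall fun z => ?_)
    simp only [h.even, symDiff₂, sub_neg_eq_add]
    ring

theorem A12.tendsto_truncated {φ : ℝ → ℝ} {α a₀ c₁ c₂ : ℝ} (h : A12 φ α a₀ c₁ c₂)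
    {C : ℝ} {f f₁ f₂ : ℝ → ℝ} (hf : BddTwice C f f₁ f₂) (x : ℝ) :
    Tendsto (fun ε => ∫ y in {y : ℝ | ε ≤ |x - y|}, φ (x - y) * (f x - f y)) (𝓝[>] 0)
      (𝓝 (levySym φ f x)) := by
  have h1 := (aecover_Ioi_of_Ioi (μ := volume) (tendsto_id'.2 nhdsWithin_le_nhds :
    Tendsto id (𝓝[>] (0:ℝ)) (𝓝 0))).integral_tendsto_of_countably_generated
      (h.integrableOn_mul_symDiff₂ hf x)
  refine Tendsto.congr' ?_ h1
  filter_upwards [self_mem_nhdsWithin] with ε hε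
  rw [(h.truncated_eq hf.continuous hf.bdd x hε).2, Measure.restrict_restrict measurableSet_Ioi]
  congr 2
  exact inter_eq_left.2 (Ioi_subset_Ioi (le_of_lt hε))

theorem A12.levy_eq {φ : ℝ → ℝ} {α a₀ c₁ c₂ : ℝ} (h : A12 φ α a₀ c₁ c₂)
    {C : ℝ} {f f₁ f₂ : ℝ → ℝ} (hf : BddTwice C f f₁ f₂) (x : ℝ) :
    levy φ f x = levySym φ f x :=
  (h.tendsto_truncated hf x).limUnder_eq

/-- Commutator form of the alignment force. -/
theorem A12.alignForce_eq {φ : ℝ → ℝ} {α a₀ c₁ c₂ : ℝ} (h : A12 φ α a₀ c₁ c₂)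
    {C C' : ℝ} {f f₁ f₂ v g₁ g₂ : ℝ → ℝ} (hf : BddTwice C f f₁ f₂)
    (hg : BddTwice C' (fun y => f y * v y) g₁ g₂) (x : ℝ) :
    alignForce φ f v x = v x * levySym φ f x - levySym φ (fun y => f y * v y) x := by
  refine Tendsto.limUnder_eq ?_
  refine Tendsto.congr' ?_ (((h.tendsto_truncated hf x).const_mul (v x)).sub
    (h.tendsto_truncated hg x))
  filter_upwards [self_mem_nhdsWithin] with ε hε
  have i1 := (h.truncated_eq hf.continuous hf.bdd x hε).1
  have i2 := (h.truncated_eq hg.continuous hg.bdd x hε).1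
  rw [← integral_const_mul, ← integral_sub (i1.const_mul (v x)) i2]
  refine integral_congr_ae (Eventually.of_forall fun z => ?_)
  simp only
  ring

/-- The Lévy operator commutes with differentiation along a parameter. -/
theorem A12.hasDerivAt_levySym_param {φ : ℝ → ℝ} {α a₀ c₁ c₂ : ℝ} (h : A12 φ α a₀ c₁ c₂)
    {C C' : ℝ} {f f' f₁ f₂ g₁ g₂ : ℝ → ℝ → ℝ} {s : Set ℝ} {p : ℝ} (hs : s ∈ 𝓝 p)
    (hf : ∀ q ∈ s, BddTwice C (f q) (f₁ q) (f₂ q))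
    (hf' : ∀ q ∈ s, BddTwice C' (f' q) (g₁ q) (g₂ q))
    (hd : ∀ q ∈ s, ∀ y, HasDerivAt (fun r => f r y) (f' q y) q) (x : ℝ) :
    HasDerivAt (fun q => levySym φ (f q) x) (levySym φ (f' p) x) p := by
  have hp := mem_of_mem_nhds hs
  refine (hasDerivAt_integral_of_dominated_loc_of_deriv_le
    (F := fun q z => φ z * symDiff₂ (f q) x z) (F' := fun q z => φ z * symDiff₂ (f' q) x z)
    (bound := fun z => 4 * C' * kernelWeight φ z) hs ?_ (h.integrableOn_mul_symDiff₂ (hf p hp) x)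
    (h.aestronglyMeasurable_mul_symDiff₂ (hf' p hp).continuous x) ?_
    (h.integrableOn_kernelWeight.const_mul _) ?_).2
  · filter_upwards [hs] with q hq
    exact h.aestronglyMeasurable_mul_symDiff₂ (hf q hq).continuous x
  · exact (ae_restrict_iff' measurableSet_Ioi).2 (Eventually.of_forall fun z hz q hq =>
      (hf' q hq).abs_mul_symDiff₂_le x hz)
  · refine Eventually.of_forall fun z q hq => ?_
    exact ((((hd q hq x).const_mul 2).sub (hd q hq (x + z))).sub (hd q hq (x - z))).const_mul (φ z)

/-- The Lévy operator commutes with the spatial derivative. -/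
theorem A12.hasDerivAt_levySym {φ : ℝ → ℝ} {α a₀ c₁ c₂ : ℝ} (h : A12 φ α a₀ c₁ c₂)
    {C C' : ℝ} {f f₁ f₂ f₃ : ℝ → ℝ} (hf : BddTwice C f f₁ f₂) (hf' : BddTwice C' f₁ f₂ f₃)
    (x : ℝ) : HasDerivAt (levySym φ f) (levySym φ f₁ x) x := by
  have key := h.hasDerivAt_levySym_param (f := fun q y => f (y + q)) (f' := fun q y => f₁ (y + q))
    (f₁ := fun q y => f₁ (y + q)) (f₂ := fun q y => f₂ (y + q)) (g₁ := fun q y => f₂ (y + q))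
    (g₂ := fun q y => f₃ (y + q)) (C := C) (C' := C') (s := univ) (p := x) univ_mem
    (fun q _ => ⟨fun y => (hf.deriv₁ (y + q)).comp_add_const y q,
      fun y => (hf.deriv₂ (y + q)).comp_add_const y q, fun y => hf.bdd _, fun y => hf.bdd₂ _⟩)
    (fun q _ => ⟨fun y => (hf'.deriv₁ (y + q)).comp_add_const y q,
      fun y => (hf'.deriv₂ (y + q)).comp_add_const y q, fun y => hf'.bdd _, fun y => hf'.bdd₂ _⟩)
    (fun q _ y => (hf.deriv₁ (y + q)).comp_const_add y q) 0
  have e : ∀ (g : ℝ → ℝ) (q : ℝ), levySym φ (fun y => g (y + q)) 0 = levySym φ g q := by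
    intro g q
    unfold levySym symDiff₂
    refine integral_congr_ae (Eventually.of_forall fun z => ?_)
    simp only [zero_add, zero_sub]
    rw [add_comm z q, neg_add_eq_sub]
  simp only [e] at key
  exact key

theorem A12.abs_deriv_neg {φ : ℝ → ℝ} {α a₀ c₁ c₂ : ℝ} (h : A12 φ α a₀ c₁ c₂) (x : ℝ) :
    |deriv φ (-x)| = |deriv φ x| := by
  have h1 := deriv_comp_neg φ x
  have h2 : (fun x => φ (-x)) = φ := funext h.even
  rw [h2] at h1
  rw [h1, abs_neg]

/-- The `W^{1,1}` norm of the kernel on the half-line beyond `a₀`. -/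
theorem A12.tail_half {φ : ℝ → ℝ} {α a₀ c₁ c₂ : ℝ} (h : A12 φ α a₀ c₁ c₂) :
    IntegrableOn (fun x => |φ x| + |deriv φ x|) (Ioi a₀) ∧
    2 * ∫ x in Ioi a₀, (|φ x| + |deriv φ x|) ≤ c₂ * (1 + a₀⁻¹) := by
  have ha := h.a₀pos
  have hsub : Ioi a₀ ⊆ {x : ℝ | a₀ ≤ |x|} := fun x hx => by
    simp only [mem_ofPred_eq]; exact (le_of_lt hx).trans (le_abs_self x)
  have fold : ∀ K : ℝ → ℝ, (∀ x, K (-x) = K x) → IntegrableOn K {x : ℝ | a₀ ≤ |x|} →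
      (∫ x in {x : ℝ | a₀ ≤ |x|}, K x) ≤ c₂ → 2 * ∫ x in Ioi a₀, K x ≤ c₂ := by
    intro K hK hi hb
    have hi' := hi.mono_set hsub
    rw [integral_abs_ge ha hi' (by simpa only [hK] using hi')] at hb
    simp only [hK, ← two_mul] at hb
    rwa [integral_const_mul] at hb
  have i0 := h.integrableOn_abs_tail
  have b0 : 2 * ∫ x in Ioi a₀, |φ x| ≤ c₂ :=
    fold (fun x => |φ x|) (fun x => by simp only [h.even])
      (by simpa using h.tailInt 0 (by norm_num)) (by simpa using h.tailBound 0 (by norm_num))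
  have t1 : IntegrableOn (fun x => |x| * |deriv φ x|) {x : ℝ | a₀ ≤ |x|} := by
    simpa [iteratedDeriv_one] using h.tailInt 1 (by norm_num)
  have b1 : 2 * ∫ x in Ioi a₀, |x| * |deriv φ x| ≤ c₂ :=
    fold (fun x => |x| * |deriv φ x|) (fun x => by simp only [h.abs_deriv_neg, abs_neg]) t1
      (by simpa [iteratedDeriv_one] using h.tailBound 1 (by norm_num))
  have t1' := (t1.mono_set hsub).const_mul a₀⁻¹
  have le1 : ∀ x ∈ Ioi a₀, |deriv φ x| ≤ a₀⁻¹ * (|x| * |deriv φ x|) := fun x hx => by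
    rw [← mul_assoc]
    refine le_mul_of_one_le_left (abs_nonneg _) ?_
    rw [inv_mul_eq_div, one_le_div ha]
    exact (le_of_lt hx).trans (le_abs_self x)
  have i1 : IntegrableOn (fun x => |deriv φ x|) (Ioi a₀) := by
    refine Integrable.mono' t1' ((h.continuousOn_deriv.abs.mono
      (Ioi_subset_Ioi ha.le)).aestronglyMeasurable measurableSet_Ioi) ?_
    refine (ae_restrict_iff' measurableSet_Ioi).2 (Eventually.of_forall fun x hx => ?_)
    simpa using le1 x hx
  refine ⟨i0.add i1, ?_⟩
  rw [integral_add i0 i1]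
  have b2 : ∫ x in Ioi a₀, |deriv φ x| ≤ a₀⁻¹ * ∫ x in Ioi a₀, |x| * |deriv φ x| := by
    rw [← integral_const_mul]
    exact setIntegral_mono_on i1 t1' measurableSet_Ioi le1
  have b3 := mul_le_mul_of_nonneg_left b1 (inv_nonneg.2 ha.le)
  linarith

theorem A12.abs_le_integral {φ : ℝ → ℝ} {α a₀ c₁ c₂ : ℝ} (h : A12 φ α a₀ c₁ c₂) {z : ℝ}
    (hz : 0 < z) : |φ z| ≤ ∫ s in z..(z + 1), (|φ s| + |deriv φ s|) := by
  have hzz : z ≤ z + 1 := by linarith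
  have hs0 : ∀ s, z ≤ s → uIcc z s ⊆ Ioi 0 := fun s hs => by
    rw [uIcc_of_le hs]; exact fun y hy => hz.trans_le hy.1
  have i0 : IntervalIntegrable (fun s => |φ s|) volume z (z + 1) :=
    (h.continuousOn_Ioi.abs.mono (hs0 _ hzz)).intervalIntegrable
  have i1 : ∀ s, z ≤ s → IntervalIntegrable (deriv φ) volume z s := fun s hs =>
    (h.continuousOn_deriv.mono (hs0 _ hs)).intervalIntegrable
  have i1' := (i1 _ hzz).abs
  have key : ∀ s ∈ Icc z (z + 1), |φ z| ≤ |φ s| + ∫ r in z..(z + 1), |deriv φ r| := by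
    intro s hs
    have ftc := intervalIntegral.integral_eq_sub_of_hasDerivAt
      (fun r hr => h.hasDerivAt (hs0 s hs.1 hr)) (i1 s hs.1)
    have n1 : |φ s - φ z| ≤ ∫ r in z..s, |deriv φ r| := by
      rw [← ftc]; exact intervalIntegral.abs_integral_le_integral_abs hs.1
    have n2 : ∫ r in z..s, |deriv φ r| ≤ ∫ r in z..(z + 1), |deriv φ r| :=
      intervalIntegral.integral_mono_interval le_rfl hs.1 hs.2
        (Eventually.of_forall fun _ => abs_nonneg _) i1'
    have n3 := abs_sub_abs_le_abs_sub (φ z) (φ s)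
    rw [abs_sub_comm] at n3
    linarith
  have := intervalIntegral.integral_mono_on hzz (f := fun _ => |φ z|)
    (g := fun s => |φ s| + ∫ r in z..(z + 1), |deriv φ r|) (by simp)
    (i0.add (by simp)) key
  rw [intervalIntegral.integral_add i0 (by simp)] at this
  rw [intervalIntegral.integral_add i0 i1']
  simpa using this

/-- Pairing the kernel tail with a nonnegative periodic function. -/
theorem A12.tail_pairing {φ : ℝ → ℝ} {α a₀ c₁ c₂ : ℝ} (h : A12 φ α a₀ c₁ c₂) {g : ℝ → ℝ}
    (hg : Continuous g) (hg0 : ∀ x, 0 ≤ g x) (hper : Function.Periodic g 1) :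
    ∫ z in Ioi a₀, |φ z| * g z ≤
      (∫ s in Ioi a₀, (|φ s| + |deriv φ s|)) * ∫ z in (0:ℝ)..1, g z := by
  have ha := h.a₀pos
  set k : ℝ → ℝ := fun s => |φ s| + |deriv φ s| with hk
  have hk0 : ∀ s, 0 ≤ k s := fun s => by positivity
  have hki : IntegrableOn k (Ioi a₀) := h.tail_half.1
  have hkm : AEMeasurable (fun s => ENNReal.ofReal (k s)) (volume.restrict (Ioi a₀)) :=
    hki.aemeasurable.ennreal_ofReal
  have hgm : Measurable fun z => ENNReal.ofReal (g z) := hg.measurable.ennreal_ofReal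
  have hI : ∀ s : ℝ, ∫⁻ z in Ico (s - 1) s, ENNReal.ofReal (g z) =
      ENNReal.ofReal (∫ z in (0:ℝ)..1, g z) := fun s => by
    have e : ∫ z in (0:ℝ)..1, g z = ∫ z in Ico (s - 1) s, g z := by
      have := hper.intervalIntegral_add_eq 0 (s - 1)
      rw [zero_add, sub_add_cancel] at this
      rw [this, intervalIntegral.integral_of_le (by linarith), integral_Ico_eq_integral_Ioc]
    rw [e, ofReal_integral_eq_lintegral_ofReal
      ((hg.integrableOn_Icc (a := s - 1) (b := s)).mono_set Ico_subset_Icc_self)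
      (Eventually.of_forall hg0)]
  have hG0 : 0 ≤ ∫ z in (0:ℝ)..1, g z :=
    intervalIntegral.integral_nonneg zero_le_one fun z _ => hg0 z
  have hK0 : 0 ≤ ∫ s in Ioi a₀, k s := integral_nonneg hk0
  let E : Set (ℝ × ℝ) := {p | p.1 < p.2 ∧ p.2 ≤ p.1 + 1}
  have hE : MeasurableSet E :=
    (measurableSet_lt measurable_fst measurable_snd).inter
      (measurableSet_le measurable_snd (measurable_fst.add_const 1))
  have main : ∫⁻ z in Ioi a₀, ENNReal.ofReal (|φ z| * g z) ≤
      ENNReal.ofReal ((∫ s in Ioi a₀, k s) * ∫ z in (0:ℝ)..1, g z) := by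
    calc ∫⁻ z in Ioi a₀, ENNReal.ofReal (|φ z| * g z)
        ≤ ∫⁻ z in Ioi a₀, ∫⁻ s in Ioi a₀, E.indicator
            (fun p => ENNReal.ofReal (k p.2) * ENNReal.ofReal (g p.1)) (z, s) := by
          refine setLIntegral_mono' measurableSet_Ioi fun z hz => ?_
          have hz0 : 0 < z := ha.trans hz
          have e1 : ∫⁻ s in Ioi a₀, E.indicator
              (fun p => ENNReal.ofReal (k p.2) * ENNReal.ofReal (g p.1)) (z, s) =
              ∫⁻ s in Ioc z (z + 1), ENNReal.ofReal (k s) * ENNReal.ofReal (g z) := by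
            have : (fun s => E.indicator
              (fun p => ENNReal.ofReal (k p.2) * ENNReal.ofReal (g p.1)) (z, s)) =
              (Ioc z (z + 1)).indicator
                (fun s => ENNReal.ofReal (k s) * ENNReal.ofReal (g z)) := by
              ext s; simp [indicator, E]
            rw [this, setLIntegral_indicator measurableSet_Ioc]
            congr 2
            exact inter_eq_left.2 fun s hs => lt_trans hz hs.1
          have hsub : Ioc z (z + 1) ⊆ Ioi a₀ := fun s hs => lt_trans hz hs.1
          rw [e1, lintegral_mul_const'' _ (hkm.mono_measure (Measure.restrict_mono hsub le_rfl)),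
            ENNReal.ofReal_mul (abs_nonneg _), ← ofReal_integral_eq_lintegral_ofReal
              (hki.mono_set hsub) (Eventually.of_forall hk0),
            ← intervalIntegral.integral_of_le (by linarith)]
          gcongr
          exact h.abs_le_integral hz0
      _ = ∫⁻ s in Ioi a₀, ∫⁻ z in Ioi a₀, E.indicator
            (fun p => ENNReal.ofReal (k p.2) * ENNReal.ofReal (g p.1)) (z, s) := by
          refine lintegral_lintegral_swap ?_
          exact (hkm.comp_snd.mul (hgm.comp measurable_fst).aemeasurable).indicator hE
      _ ≤ ∫⁻ s in Ioi a₀, ENNReal.ofReal (k s) * ENNReal.ofReal (∫ z in (0:ℝ)..1, g z) := by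
          refine lintegral_mono fun s => ?_
          have e2 : (fun z => E.indicator
              (fun p => ENNReal.ofReal (k p.2) * ENNReal.ofReal (g p.1)) (z, s)) =
              (Ico (s - 1) s).indicator
                (fun z => ENNReal.ofReal (k s) * ENNReal.ofReal (g z)) := by
            ext z; simp [indicator, E, and_comm]
          simp only
          rw [e2]
          refine (setLIntegral_le_lintegral _ _).trans ?_
          rw [lintegral_indicator measurableSet_Ico, lintegral_const_mul _ hgm, hI]
      _ = ENNReal.ofReal ((∫ s in Ioi a₀, k s) * ∫ z in (0:ℝ)..1, g z) := by
          rw [lintegral_mul_const'' _ hkm, ENNReal.ofReal_mul hK0,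
            ofReal_integral_eq_lintegral_ofReal hki (Eventually.of_forall hk0)]
  rw [integral_eq_lintegral_of_nonneg_ae
    (Eventually.of_forall fun z => mul_nonneg (abs_nonneg _) (hg0 z))
    ((h.continuousOn_Ioi.abs.mul hg.continuousOn).mono
      (Ioi_subset_Ioi ha.le) |>.aestronglyMeasurable measurableSet_Ioi)]
  exact ENNReal.toReal_le_of_le_ofReal (mul_nonneg hK0 hG0) main

/-- At a global minimum of a nonnegative periodic function the Lévy operator is controlled by
the mean. -/
theorem A12.levySym_le_of_isMin {φ : ℝ → ℝ} {α a₀ c₁ c₂ : ℝ} (h : A12 φ α a₀ c₁ c₂)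
    {C : ℝ} {f f₁ f₂ : ℝ → ℝ} (hf : BddTwice C f f₁ f₂) (hper : Function.Periodic f 1)
    {x : ℝ} (hx : ∀ y, f x ≤ f y) (hx0 : 0 ≤ f x) :
    levySym φ f x ≤ c₂ * (1 + a₀⁻¹) * ∫ y in (-(1:ℝ)/2)..(1/2), f y := by
  have ha := h.a₀pos
  have hint := h.integrableOn_mul_symDiff₂ hf x
  have hD : ∀ z, symDiff₂ f x z ≤ 0 := fun z => by
    unfold symDiff₂; linarith [hx (x + z), hx (x - z)]
  have hDper : Function.Periodic (fun z => -symDiff₂ f x z) 1 := fun z => by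
    have h1 := hper (x + z)
    have h2 := hper (x - (z + 1))
    simp only [symDiff₂]
    rw [← add_assoc, h1, ← h2]
    ring_nf
  have step1 : levySym φ f x ≤ ∫ z in Ioi a₀, |φ z| * (-symDiff₂ f x z) := by
    unfold levySym
    rw [← Ioc_union_Ioi_eq_Ioi ha.le] at hint ⊢
    rw [setIntegral_union (Ioc_disjoint_Ioi le_rfl) measurableSet_Ioi
      (hint.mono_set subset_union_left) (hint.mono_set subset_union_right)]
    have n1 : ∫ z in Ioc 0 a₀, φ z * symDiff₂ f x z ≤ 0 :=
      setIntegral_nonpos measurableSet_Ioc fun z hz =>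
        mul_nonpos_of_nonneg_of_nonpos (h.nonneg hz.1 hz.2) (hD z)
    have n2 : ∫ z in Ioi a₀, φ z * symDiff₂ f x z ≤
        ∫ z in Ioi a₀, |φ z| * (-symDiff₂ f x z) := by
      have hi := hint.mono_set (subset_union_right (s := Ioc 0 a₀) (t := Ioi a₀))
      have e : (fun z => |φ z| * (-symDiff₂ f x z)) = fun z => |φ z * symDiff₂ f x z| := by
        ext z; rw [abs_mul, abs_of_nonpos (hD z)]
      rw [e]
      exact integral_mono hi hi.abs fun z => le_abs_self _
    linarith
  have step2 := h.tail_pairing (g := fun z => -symDiff₂ f x z)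
    (symDiff₂_continuous hf.continuous x).neg (fun z => by linarith [hD z]) hDper
  have hI : ∫ z in (0:ℝ)..1, -symDiff₂ f x z =
      2 * ((∫ y in (-(1:ℝ)/2)..(1/2), f y) - f x) := by
    have hc := hf.continuous
    have p1 := hper.intervalIntegral_add_eq (-(1:ℝ)/2) x
    have p2 := hper.intervalIntegral_add_eq (-(1:ℝ)/2) (x - 1)
    have e0 : (-(1:ℝ)/2) + 1 = 1/2 := by norm_num
    rw [e0] at p1 p2
    rw [sub_add_cancel] at p2
    have e1 : ∫ z in (0:ℝ)..1, f (x + z) = ∫ y in (-(1:ℝ)/2)..(1/2), f y := by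
      rw [intervalIntegral.integral_comp_add_left, p1, add_zero]
    have e2 : ∫ z in (0:ℝ)..1, f (x - z) = ∫ y in (-(1:ℝ)/2)..(1/2), f y := by
      rw [intervalIntegral.integral_comp_sub_left, p2, sub_zero]
    have e3 : (fun z => -symDiff₂ f x z) = fun z => (f (x + z) + f (x - z)) - 2 * f x := by
      ext z; unfold symDiff₂; ring
    have j1 : IntervalIntegrable (fun z => f (x + z)) volume 0 1 :=
      Continuous.intervalIntegrable (by fun_prop) _ _
    have j2 : IntervalIntegrable (fun z => f (x - z)) volume 0 1 :=
      Continuous.intervalIntegrable (by fun_prop) _ _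
    rw [e3, intervalIntegral.integral_sub (j1.add j2) (by simp),
      intervalIntegral.integral_add j1 j2, e1, e2]
    simp; ring
  rw [hI] at step2
  have hmean : f x ≤ ∫ y in (-(1:ℝ)/2)..(1/2), f y := by
    have := intervalIntegral.integral_mono_on (μ := volume) (a := -(1:ℝ)/2) (b := 1/2) (by norm_num)
      (f := fun _ => f x) (g := f) (continuous_const.intervalIntegrable _ _)
      (hf.continuous.intervalIntegrable _ _)
      (fun y _ => hx y)
    rw [intervalIntegral.integral_const] at this
    norm_num at this ⊢
    exact this
  have ht := mul_le_mul_of_nonneg_right h.tail_half.2 (sub_nonneg.2 hmean)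
  have hκ : 0 ≤ c₂ * (1 + a₀⁻¹) := by have := h.c₂pos; positivity
  have := mul_nonneg hκ hx0
  nlinarith

/-- The closed space-time strip. -/
def strip (T : ℝ) : Set (ℝ × ℝ) := univ ×ˢ Icc 0 T

/-- Smooth functions on the closed strip that are 1-periodic in space. -/
structure SmoothPeriodic (T : ℝ) (f : ℝ → ℝ → ℝ) : Prop where
  smooth : ContDiffOn ℝ (⊤ : ℕ∞) (Function.uncurry f) (strip T)
  periodic : ∀ x t, f (x + 1) t = f x t

/-- Spatial derivative. -/
def dX (f : ℝ → ℝ → ℝ) (x t : ℝ) : ℝ := deriv (fun y => f y t) x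

/-- Time derivative within `[0,T]`. -/
def dT (T : ℝ) (f : ℝ → ℝ → ℝ) (x t : ℝ) : ℝ := derivWithin (fun s => f x s) (Icc 0 T) t

theorem strip_uniqueDiffOn {T : ℝ} (hT : 0 < T) : UniqueDiffOn ℝ (strip T) :=
  uniqueDiffOn_univ.prod (uniqueDiffOn_Icc hT)

theorem strip_mem_nhds {T x t : ℝ} (ht : t ∈ Ioo 0 T) : strip T ∈ 𝓝 (x, t) :=
  prod_mem_nhds univ_mem (Icc_mem_nhds ht.1 ht.2)

/-- Continuous functions on the strip that are periodic in space are bounded. -/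
theorem exists_bound_of_continuousOn_strip {T : ℝ} {f : ℝ → ℝ → ℝ}
    (hf : ContinuousOn (Function.uncurry f) (strip T))
    (hper : ∀ t ∈ Icc 0 T, ∀ x, f (x + 1) t = f x t) :
    ∃ C, ∀ t ∈ Icc 0 T, ∀ x, |f x t| ≤ C := by
  have hK : IsCompact (Icc (0:ℝ) 1 ×ˢ Icc 0 T) := isCompact_Icc.prod isCompact_Icc
  obtain ⟨C, hC⟩ := hK.exists_bound_of_continuousOn (hf.mono fun p hp => ⟨mem_univ _, hp.2⟩)
  refine ⟨C, fun t ht x => ?_⟩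
  obtain ⟨y, hy, hxy⟩ := Function.Periodic.exists_mem_Ico₀ (f := fun x => f x t)
    (hper t ht) one_pos x
  rw [hxy]
  exact hC (y, t) ⟨Ico_subset_Icc_self hy, ht⟩

namespace SmoothPeriodic

variable {T : ℝ} {f g : ℝ → ℝ → ℝ}

theorem mul (hf : SmoothPeriodic T f) (hg : SmoothPeriodic T g) :
    SmoothPeriodic T (fun x t => f x t * g x t) :=
  ⟨hf.smooth.mul hg.smooth, fun x t => by rw [hf.periodic, hg.periodic]⟩

theorem exists_bound (hf : SmoothPeriodic T f) : ∃ C, ∀ t ∈ Icc 0 T, ∀ x, |f x t| ≤ C :=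
  exists_bound_of_continuousOn_strip hf.smooth.continuousOn fun t _ x => hf.periodic x t

theorem hasFDerivWithinAt (hf : SmoothPeriodic T f) {x t : ℝ} (ht : t ∈ Icc 0 T) :
    HasFDerivWithinAt (Function.uncurry f) (fderivWithin ℝ (Function.uncurry f) (strip T) (x, t))
      (strip T) (x, t) :=
  (hf.smooth.differentiableOn (by simp) (x, t) ⟨mem_univ _, ht⟩).hasFDerivWithinAt

theorem hasDerivAt_space_aux (hf : SmoothPeriodic T f) {x t : ℝ} (ht : t ∈ Icc 0 T) :
    HasDerivAt (fun y => f y t)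
      (fderivWithin ℝ (Function.uncurry f) (strip T) (x, t) (1, 0)) x := by
  have h1 : HasDerivWithinAt (fun y : ℝ => (y, t)) ((1:ℝ), (0:ℝ)) univ x :=
    ((hasDerivAt_id x).prodMk (hasDerivAt_const x t)).hasDerivWithinAt
  have := (hf.hasFDerivWithinAt ht (x := x)).comp_hasDerivWithinAt x h1
    (show MapsTo (fun y : ℝ => (y, t)) univ (strip T) from fun y _ => ⟨mem_univ _, ht⟩)
  exact hasDerivWithinAt_univ.1 this

theorem hasDerivWithinAt_time_aux (hf : SmoothPeriodic T f) {x t : ℝ} (ht : t ∈ Icc 0 T) :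
    HasDerivWithinAt (fun s => f x s)
      (fderivWithin ℝ (Function.uncurry f) (strip T) (x, t) (0, 1)) (Icc 0 T) t := by
  have h1 : HasDerivWithinAt (fun s : ℝ => (x, s)) ((0:ℝ), (1:ℝ)) (Icc 0 T) t :=
    ((hasDerivAt_const t x).prodMk (hasDerivAt_id t)).hasDerivWithinAt
  exact (hf.hasFDerivWithinAt ht (x := x)).comp_hasDerivWithinAt t h1
    (fun s hs => ⟨mem_univ _, hs⟩)

theorem dX_eq (hf : SmoothPeriodic T f) {x t : ℝ} (ht : t ∈ Icc 0 T) :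
    dX f x t = fderivWithin ℝ (Function.uncurry f) (strip T) (x, t) (1, 0) :=
  (hf.hasDerivAt_space_aux ht).deriv

theorem dT_eq (hT : 0 < T) (hf : SmoothPeriodic T f) {x t : ℝ} (ht : t ∈ Icc 0 T) :
    dT T f x t = fderivWithin ℝ (Function.uncurry f) (strip T) (x, t) (0, 1) :=
  (hf.hasDerivWithinAt_time_aux ht).derivWithin (uniqueDiffOn_Icc hT t ht)

theorem hasDerivAt_dX (hf : SmoothPeriodic T f) {x t : ℝ} (ht : t ∈ Icc 0 T) :
    HasDerivAt (fun y => f y t) (dX f x t) x := by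
  rw [hf.dX_eq ht]; exact hf.hasDerivAt_space_aux ht

theorem hasDerivAt_dT (hT : 0 < T) (hf : SmoothPeriodic T f) {x t : ℝ} (ht : t ∈ Ioo 0 T) :
    HasDerivAt (fun s => f x s) (dT T f x t) t := by
  rw [hf.dT_eq hT (Ioo_subset_Icc_self ht)]
  exact (hf.hasDerivWithinAt_time_aux (Ioo_subset_Icc_self ht)).hasDerivAt
    (Icc_mem_nhds ht.1 ht.2)

theorem contDiffOn_fderivWithin_apply (hT : 0 < T) (hf : SmoothPeriodic T f) (v : ℝ × ℝ) :
    ContDiffOn ℝ (⊤ : ℕ∞) (fun p => fderivWithin ℝ (Function.uncurry f) (strip T) p v)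
      (strip T) :=
  (hf.smooth.fderivWithin (strip_uniqueDiffOn hT) (by simp)).clm_apply contDiffOn_const

theorem space (hT : 0 < T) (hf : SmoothPeriodic T f) : SmoothPeriodic T (dX f) where
  smooth := (hf.contDiffOn_fderivWithin_apply hT (1, 0)).congr fun p hp => hf.dX_eq hp.2
  periodic x t := by
    unfold dX
    rw [← deriv_comp_add_const]
    simp only [hf.periodic]

theorem time (hT : 0 < T) (hf : SmoothPeriodic T f) : SmoothPeriodic T (dT T f) where
  smooth := (hf.contDiffOn_fderivWithin_apply hT (0, 1)).congr fun p hp => hf.dT_eq hT hp.2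
  periodic x t := by
    unfold dT
    simp only [hf.periodic]

theorem dT_dX_comm (hT : 0 < T) (hf : SmoothPeriodic T f) {x t : ℝ} (ht : t ∈ Ioo 0 T) :
    dT T (dX f) x t = dX (dT T f) x t := by
  set F := Function.uncurry f
  have hc : ContDiffAt ℝ (⊤ : ℕ∞) F (x, t) := hf.smooth.contDiffAt (strip_mem_nhds ht)
  have two_le : (2 : WithTop ℕ∞) ≤ ((⊤ : ℕ∞) : WithTop ℕ∞) := WithTop.coe_le_coe.2 le_top
  have hsymm := hc.isSymmSndFDerivAt (by simpa using two_le)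
  have hd : HasFDerivAt (fderiv ℝ F) (fderiv ℝ (fderiv ℝ F) (x, t)) (x, t) :=
    ((hc.fderiv_right (m := 1) (by rw [one_add_one_eq_two]; exact two_le)).differentiableAt
      (by simp)).hasFDerivAt
  have hev : ∀ v : ℝ × ℝ, HasFDerivAt (fun p => fderiv ℝ F p v)
      ((fderiv ℝ (fderiv ℝ F) (x, t)).flip v) (x, t) := fun v => by
    have := hd.clm_apply (hasFDerivAt_const v (x, t))
    refine this.congr_fderiv ?_
    ext <;> simp
  have hint : ∀ᶠ p in 𝓝 (x, t), fderivWithin ℝ F (strip T) p = fderiv ℝ F p ∧ p.2 ∈ Icc 0 T := by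
    have : univ ×ˢ Ioo 0 T ∈ 𝓝 (x, t) := prod_mem_nhds univ_mem (Ioo_mem_nhds ht.1 ht.2)
    filter_upwards [this] with p hp
    exact ⟨fderivWithin_of_mem_nhds (strip_mem_nhds hp.2), Ioo_subset_Icc_self hp.2⟩
  have h1 : HasDerivAt (fun s => dX f x s)
      (fderiv ℝ (fderiv ℝ F) (x, t) (0, 1) (1, 0)) t := by
    have hl : HasDerivAt (fun s : ℝ => (x, s)) ((0:ℝ), (1:ℝ)) t :=
      (hasDerivAt_const t x).prodMk (hasDerivAt_id t)
    have := (hev (1, 0)).comp_hasDerivAt t hl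
    refine this.congr_of_eventuallyEq ?_
    filter_upwards [hl.continuousAt.eventually hint] with s hs
    rw [hf.dX_eq hs.2]; simp only [Function.comp_apply]; rw [← hs.1]
  have h2 : HasDerivAt (fun y => dT T f y t)
      (fderiv ℝ (fderiv ℝ F) (x, t) (1, 0) (0, 1)) x := by
    have hl : HasDerivAt (fun y : ℝ => (y, t)) ((1:ℝ), (0:ℝ)) x :=
      (hasDerivAt_id x).prodMk (hasDerivAt_const x t)
    have := (hev (0, 1)).comp_hasDerivAt x hl
    refine this.congr_of_eventuallyEq ?_
    filter_upwards [hl.continuousAt.eventually hint] with s hs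
    rw [hf.dT_eq hT hs.2]; simp only [Function.comp_apply]; rw [← hs.1]
  have e1 : dT T (dX f) x t = _ := ((hf.space hT).hasDerivAt_dT hT ht).unique h1
  have e2 : dX (dT T f) x t = _ := h2.deriv
  rw [e1, e2, hsymm.eq]

/-- Uniform bounds on a smooth periodic function and its second spatial derivative. -/
theorem exists_bddTwice (hT : 0 < T) (hf : SmoothPeriodic T f) :
    ∃ C, ∀ t ∈ Icc 0 T,
      BddTwice C (fun x => f x t) (fun x => dX f x t) (fun x => dX (dX f) x t) := by
  obtain ⟨C, hC⟩ := hf.exists_bound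
  obtain ⟨C', hC'⟩ := ((hf.space hT).space hT).exists_bound
  exact ⟨max C C', fun t ht => ⟨fun x => hf.hasDerivAt_dX ht,
    fun x => (hf.space hT).hasDerivAt_dX ht, fun x => (hC t ht x).trans (le_max_left _ _),
    fun x => (hC' t ht x).trans (le_max_right _ _)⟩⟩

theorem continuousOn_levySym {φ : ℝ → ℝ} {α a₀ c₁ c₂ : ℝ} (h : A12 φ α a₀ c₁ c₂) (hT : 0 < T)
    (hf : SmoothPeriodic T f) :
    ContinuousOn (fun p : ℝ × ℝ => levySym φ (fun y => f y p.2) p.1) (strip T) := by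
  obtain ⟨C, hC⟩ := hf.exists_bddTwice hT
  refine continuousOn_of_dominated (bound := fun z => 4 * C * kernelWeight φ z) ?_ ?_
    (h.integrableOn_kernelWeight.const_mul _) ?_
  · intro p hp
    exact h.aestronglyMeasurable_mul_symDiff₂ (hC p.2 hp.2).continuous p.1
  · intro p hp
    exact (ae_restrict_iff' measurableSet_Ioi).2 (Eventually.of_forall fun z hz =>
      (hC p.2 hp.2).abs_mul_symDiff₂_le p.1 hz)
  · refine Eventually.of_forall fun z => ?_
    have hs : ∀ a : ℝ, ContinuousOn (fun p : ℝ × ℝ => f (p.1 + a) p.2) (strip T) := fun a =>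
      hf.smooth.continuousOn.comp (f := fun p : ℝ × ℝ => (p.1 + a, p.2)) (by fun_prop)
        fun p hp => ⟨mem_univ _, hp.2⟩
    unfold symDiff₂
    have h0 := hs 0
    have h1 := hs z
    have h2 := hs (-z)
    simp only [add_zero, ← sub_eq_add_neg] at h0 h2
    exact continuousOn_const.mul (((continuousOn_const.mul h0).sub h1).sub h2)

theorem hasDerivAt_levySym_time {φ : ℝ → ℝ} {α a₀ c₁ c₂ : ℝ} (h : A12 φ α a₀ c₁ c₂) (hT : 0 < T)
    (hf : SmoothPeriodic T f) {x t : ℝ} (ht : t ∈ Ioo 0 T) :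
    HasDerivAt (fun s => levySym φ (fun y => f y s) x) (levySym φ (fun y => dT T f y t) x) t := by
  obtain ⟨C, hC⟩ := hf.exists_bddTwice hT
  obtain ⟨C', hC'⟩ := (hf.time hT).exists_bddTwice hT
  exact h.hasDerivAt_levySym_param (f := fun s y => f y s) (f' := fun s y => dT T f y s)
    (Ioo_mem_nhds ht.1 ht.2)
    (fun q hq => hC q (Ioo_subset_Icc_self hq)) (fun q hq => hC' q (Ioo_subset_Icc_self hq))
    (fun q hq y => hf.hasDerivAt_dT hT hq) x

theorem hasDerivAt_levySym_space {φ : ℝ → ℝ} {α a₀ c₁ c₂ : ℝ} (h : A12 φ α a₀ c₁ c₂) (hT : 0 < T)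
    (hf : SmoothPeriodic T f) {x t : ℝ} (ht : t ∈ Icc 0 T) :
    HasDerivAt (fun y => levySym φ (fun y => f y t) y) (levySym φ (fun y => dX f y t) x) x := by
  obtain ⟨C, hC⟩ := hf.exists_bddTwice hT
  obtain ⟨C', hC'⟩ := (hf.space hT).exists_bddTwice hT
  exact h.hasDerivAt_levySym (hC t ht) (hC' t ht) x

/-- Spatial derivatives of periodic functions have zero mean, so a density transported in
divergence form has constant mass. -/
theorem mass_conservation (hT : 0 < T) (hf : SmoothPeriodic T f) (hg : SmoothPeriodic T g)
    (heq : ∀ x, ∀ t ∈ Ioo 0 T, dT T f x t = -dX g x t) {t : ℝ} (ht : t ∈ Icc 0 T) :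
    ∫ x in (-(1:ℝ)/2)..(1/2), f x t = ∫ x in (-(1:ℝ)/2)..(1/2), f x 0 := by
  have hle : (-(1:ℝ)/2) ≤ 1/2 := by norm_num
  simp only [intervalIntegral.integral_of_le hle]
  obtain ⟨C, hC⟩ := hf.exists_bound
  obtain ⟨C', hC'⟩ := (hf.time hT).exists_bound
  have hsl : ∀ {k : ℝ → ℝ → ℝ}, SmoothPeriodic T k → ∀ s ∈ Icc 0 T, Continuous fun x => k x s :=
    fun hk s hs => continuous_iff_continuousAt.2 fun x => (hk.hasDerivAt_dX hs).continuousAt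
  have hcont : ContinuousOn (fun s => ∫ x in Ioc (-(1:ℝ)/2) (1/2), f x s) (Icc 0 T) := by
    refine continuousOn_of_dominated (bound := fun _ => C)
      (fun s hs => (hsl hf s hs).aestronglyMeasurable)
      (fun s hs => Eventually.of_forall fun x => hC s hs x) (by simp) ?_
    refine Eventually.of_forall fun x => ?_
    exact hf.smooth.continuousOn.comp (f := fun s : ℝ => (x, s)) (by fun_prop)
      fun s hs => ⟨mem_univ _, hs⟩
  have hder : ∀ s ∈ Ioo 0 T, HasDerivAt (fun s => ∫ x in Ioc (-(1:ℝ)/2) (1/2), f x s) 0 s := by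
    intro s hs
    have hs' := Ioo_subset_Icc_self hs
    have key := (hasDerivAt_integral_of_dominated_loc_of_deriv_le
      (μ := volume.restrict (Ioc (-(1:ℝ)/2) (1/2)))
      (F := fun s x => f x s) (F' := fun s x => dT T f x s) (bound := fun _ => C')
      (Ioo_mem_nhds hs.1 hs.2) ?_ ((hsl hf s hs').integrableOn_Ioc)
      (hsl (hf.time hT) s hs').aestronglyMeasurable
      (Eventually.of_forall fun x q hq => hC' q (Ioo_subset_Icc_self hq) x) (by simp)
      (Eventually.of_forall fun x q hq => hf.hasDerivAt_dT hT hq)).2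
    · refine key.congr_deriv ?_
      simp only [heq _ s hs]
      rw [← intervalIntegral.integral_of_le hle, intervalIntegral.integral_neg,
        intervalIntegral.integral_eq_sub_of_hasDerivAt (f := fun x => g x s)
          (fun x _ => hg.hasDerivAt_dX hs')
          ((hsl (hg.space hT) s hs').intervalIntegrable _ _)]
      have := hg.periodic (-(1:ℝ)/2) s
      norm_num at this ⊢
      linarith
    · filter_upwards [Ioo_mem_nhds hs.1 hs.2] with q hq
      exact (hsl hf q (Ioo_subset_Icc_self hq)).aestronglyMeasurable
  rcases ht.1.eq_or_lt with h0 | h0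
  · rw [← h0]
  · obtain ⟨c, hc, hc'⟩ := exists_hasDerivAt_eq_slope
      (fun s => ∫ x in Ioc (-(1:ℝ)/2) (1/2), f x s) (fun _ => 0) h0
      (hcont.mono (Icc_subset_Icc_right ht.2)) (fun s hs => hder s ⟨hs.1, hs.2.trans_le ht.2⟩)
    rw [eq_comm, div_eq_zero_iff] at hc'
    rcases hc' with h1 | h1 <;> linarith

end SmoothPeriodic

/-- Minimum principle on the periodic strip. -/
theorem nonneg_of_deriv_pos_at_neg_min {T : ℝ} (hT : 0 < T) {W : ℝ → ℝ → ℝ}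
    (hc : ContinuousOn (Function.uncurry W) (strip T))
    (hper : ∀ t ∈ Icc 0 T, ∀ x, W (x + 1) t = W x t) (h0 : ∀ x, 0 ≤ W x 0)
    (hmin : ∀ t ∈ Ioo 0 T, ∀ x, (∀ y, W x t ≤ W y t) → W x t < 0 →
      ∃ W', HasDerivAt (fun s => W x s) W' t ∧ 0 < W') :
    ∀ t ∈ Icc 0 T, ∀ x, 0 ≤ W x t := by
  have hopen : ∀ t ∈ Ico 0 T, ∀ x, 0 ≤ W x t := by
    intro t ht x
    by_contra! hneg
    have hrep : ∀ s ∈ Icc 0 T, ∀ y, ∃ y' ∈ Icc (0:ℝ) 1, W y s = W y' s := fun s hs y => by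
      obtain ⟨y', hy', h⟩ := Function.Periodic.exists_mem_Ico₀ (f := fun x => W x s)
        (hper s hs) one_pos y
      exact ⟨y', Ico_subset_Icc_self hy', h⟩
    have hsub : Icc (0:ℝ) 1 ×ˢ Icc 0 t ⊆ strip T := fun p hp =>
      ⟨mem_univ _, hp.2.1, hp.2.2.trans ht.2.le⟩
    obtain ⟨⟨x₀, t₀⟩, hm, hle⟩ := (isCompact_Icc.prod isCompact_Icc).exists_isMinOn
      ⟨((0:ℝ), (0:ℝ)), ⟨by simp, by simpa using ht.1⟩⟩ (hc.mono hsub)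
    have hle' : ∀ s ∈ Icc 0 t, ∀ y, W x₀ t₀ ≤ W y s := fun s hs y => by
      obtain ⟨y', hy', e⟩ := hrep s ⟨hs.1, hs.2.trans ht.2.le⟩ y
      rw [e]
      exact hle (show (y', s) ∈ Icc (0:ℝ) 1 ×ˢ Icc 0 t from ⟨hy', hs⟩)
    have ht₀ : t₀ ∈ Icc 0 t := hm.2
    have hneg₀ : W x₀ t₀ < 0 := (hle' t ⟨ht.1, le_rfl⟩ x).trans_lt hneg
    have hpos : 0 < t₀ := by
      refine ht₀.1.lt_of_ne fun e => ?_
      rw [← e] at hneg₀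
      exact absurd (h0 x₀) (not_le.2 hneg₀)
    obtain ⟨W', hW', hW'pos⟩ := hmin t₀ ⟨hpos, ht₀.2.trans_lt ht.2⟩ x₀ (hle' t₀ ht₀) hneg₀
    have hs := (hasDerivWithinAt_iff_tendsto_slope' self_notMem_Iio).1
      (hW'.hasDerivWithinAt (s := Iio t₀))
    refine absurd (le_of_tendsto hs ?_) (not_le.2 hW'pos)
    filter_upwards [Ioo_mem_nhdsLT hpos] with s hs
    rw [slope_def_field]
    exact div_nonpos_of_nonneg_of_nonpos
      (sub_nonneg.2 (hle' s ⟨hs.1.le, hs.2.le.trans ht₀.2⟩ x₀)) (by linarith [hs.2])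
  intro t ht x
  rcases ht.2.lt_or_eq with h | rfl
  · exact hopen t ⟨ht.1, h⟩ x
  · have hcx : ContinuousWithinAt (fun s => W x s) (Icc 0 t) t :=
      (hc.comp (f := fun s : ℝ => (x, s)) (by fun_prop) fun s hs => ⟨mem_univ _, hs⟩) t ht
    have hcx' := (hcx.mono Ico_subset_Icc_self).tendsto
    have : (𝓝[Ico 0 t] t).NeBot := by
      rw [← mem_closure_iff_nhdsWithin_neBot, closure_Ico hT.ne]
      exact ht
    exact ge_of_tendsto hcx' (by filter_upwards [self_mem_nhdsWithin] with s hs using hopen s hs x)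

/-- Solutions of linear transport equations with bounded zeroth order coefficient preserve
nonnegativity. -/
theorem nonneg_of_transport {T : ℝ} (hT : 0 < T) {H Hx Ht v c : ℝ → ℝ → ℝ} {K : ℝ}
    (hc : ContinuousOn (Function.uncurry H) (strip T))
    (hper : ∀ t ∈ Icc 0 T, ∀ x, H (x + 1) t = H x t) (h0 : ∀ x, 0 ≤ H x 0)
    (hK : ∀ t ∈ Icc 0 T, ∀ x, |c x t| ≤ K)
    (hx : ∀ t ∈ Ioo 0 T, ∀ x, HasDerivAt (fun y => H y t) (Hx x t) x)
    (ht : ∀ t ∈ Ioo 0 T, ∀ x, HasDerivAt (fun s => H x s) (Ht x t) t)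
    (heq : ∀ t ∈ Ioo 0 T, ∀ x, Ht x t + v x t * Hx x t + c x t * H x t = 0) :
    ∀ t ∈ Icc 0 T, ∀ x, 0 ≤ H x t := by
  have key := nonneg_of_deriv_pos_at_neg_min hT
    (W := fun x t => Real.exp (-(K + 1) * t) * H x t) ?_ ?_ ?_ ?_
  · intro t ht x
    exact nonneg_of_mul_nonneg_right (key t ht x) (Real.exp_pos _)
  · exact ContinuousOn.mul (f := fun p : ℝ × ℝ => Real.exp (-(K + 1) * p.2)) (by fun_prop) hc
  · intro t ht x
    simp only [hper t ht x]
  · intro x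
    simpa using h0 x
  · intro t htt x hmin hneg
    have he := Real.exp_pos (-(K + 1) * t)
    have hHneg : H x t < 0 := by
      by_contra! hH
      exact absurd hneg (not_lt.2 (mul_nonneg he.le hH))
    have hHmin : ∀ y, H x t ≤ H y t := fun y => le_of_mul_le_mul_left (hmin y) he
    have hx0 : Hx x t = 0 :=
      IsLocalMin.hasDerivAt_eq_zero (Eventually.of_forall hHmin) (hx t htt x)
    have hexp : HasDerivAt (fun s => Real.exp (-(K + 1) * s))
        (Real.exp (-(K + 1) * t) * (-(K + 1))) t := by
      have := ((hasDerivAt_id t).const_mul (-(K + 1))).exp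
      simpa using this
    refine ⟨_, hexp.mul (ht t htt x), ?_⟩
    have e := heq t htt x
    rw [hx0] at e
    have hck := abs_le.1 (hK t (Ioo_subset_Icc_self htt) x)
    have e2 : Real.exp (-(K + 1) * t) * (-(K + 1)) * H x t + Real.exp (-(K + 1) * t) * Ht x t =
        Real.exp (-(K + 1) * t) * ((c x t + K + 1) * (-H x t)) := by
      have : Ht x t = -(c x t * H x t) := by linarith
      rw [this]; ring
    rw [e2]
    exact mul_pos he (mul_pos (by linarith) (by linarith))

namespace EASol

variable {φ : ℝ → ℝ} {α a₀ c₁ c₂ T : ℝ} {ρ u : ℝ → ℝ → ℝ}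

theorem rho (hsol : EASol φ T ρ u) : SmoothPeriodic T ρ := ⟨hsol.smooth_rho, hsol.periodic_rho⟩

theorem vel (hsol : EASol φ T ρ u) : SmoothPeriodic T u := ⟨hsol.smooth_u, hsol.periodic_u⟩

/-- The conserved quantity `G = ∂ₓu - 𝓛ρ`. -/
def vortex (φ : ℝ → ℝ) (ρ u : ℝ → ℝ → ℝ) (x t : ℝ) : ℝ :=
  dX u x t - levySym φ (fun y => ρ y t) x

theorem continuousOn_vortex (h : A12 φ α a₀ c₁ c₂) (hT : 0 < T) (hsol : EASol φ T ρ u) :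
    ContinuousOn (Function.uncurry (vortex φ ρ u)) (strip T) :=
  (hsol.vel.space hT).smooth.continuousOn.sub (hsol.rho.continuousOn_levySym h hT)

theorem vortex_periodic (hsol : EASol φ T ρ u) (x t : ℝ) :
    vortex φ ρ u (x + 1) t = vortex φ ρ u x t := by
  have h1 : dX u (x + 1) t = dX u x t := by
    unfold dX
    rw [← deriv_comp_add_const]
    simp only [hsol.periodic_u]
  have h2 : levySym φ (fun y => ρ y t) (x + 1) = levySym φ (fun y => ρ y t) x := by
    unfold levySym symDiff₂
    refine integral_congr_ae (Eventually.of_forall fun z => ?_)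
    simp only
    rw [hsol.periodic_rho, add_right_comm, hsol.periodic_rho, add_sub_right_comm,
      hsol.periodic_rho]
  rw [vortex, vortex, h1, h2]

theorem dT_rho (hsol : EASol φ T ρ u) {t : ℝ} (ht : t ∈ Icc 0 T) (x : ℝ) :
    dT T ρ x t = -dX (fun x t => ρ x t * u x t) x t :=
  eq_neg_of_add_eq_zero_left (hsol.mass x t ht)

theorem dX_flux (hsol : EASol φ T ρ u) {t : ℝ} (ht : t ∈ Icc 0 T) (x : ℝ) :
    dX (fun x t => ρ x t * u x t) x t = dX ρ x t * u x t + ρ x t * dX u x t :=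
  ((hsol.rho.hasDerivAt_dX ht).mul (hsol.vel.hasDerivAt_dX ht)).deriv

theorem dT_vel (h : A12 φ α a₀ c₁ c₂) (hT : 0 < T) (hsol : EASol φ T ρ u) {t : ℝ}
    (ht : t ∈ Icc 0 T) (x : ℝ) :
    dT T u x t = u x t * levySym φ (fun y => ρ y t) x - levySym φ (fun y => ρ y t * u y t) x
      - u x t * dX u x t := by
  obtain ⟨C, hC⟩ := hsol.rho.exists_bddTwice hT
  obtain ⟨C', hC'⟩ := (hsol.rho.mul hsol.vel).exists_bddTwice hT
  have := hsol.mom x t ht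
  rw [h.alignForce_eq (hC t ht) (hC' t ht) x] at this
  exact eq_sub_of_add_eq this

/-- `G` solves the continuity equation. -/
theorem vortex_transport (h : A12 φ α a₀ c₁ c₂) (hT : 0 < T) (hsol : EASol φ T ρ u) {t : ℝ}
    (ht : t ∈ Ioo 0 T) (x : ℝ) : ∃ Gt Gx : ℝ,
    HasDerivAt (fun s => vortex φ ρ u x s) Gt t ∧ HasDerivAt (fun y => vortex φ ρ u y t) Gx x ∧
      Gt + u x t * Gx + dX u x t * vortex φ ρ u x t = 0 := by
  have ht' := Ioo_subset_Icc_self ht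
  have hu := hsol.vel
  have hρ := hsol.rho
  have hρu := hρ.mul hu
  refine ⟨_, _, ((hu.space hT).hasDerivAt_dT hT ht).sub (hρ.hasDerivAt_levySym_time h hT ht),
    ((hu.space hT).hasDerivAt_dX ht').sub (hρ.hasDerivAt_levySym_space h hT ht'), ?_⟩
  have e1 : levySym φ (fun y => dT T ρ y t) x =
      -levySym φ (fun y => dX (fun x t => ρ x t * u x t) y t) x := by
    unfold levySym
    rw [← integral_neg]
    refine integral_congr_ae (Eventually.of_forall fun z => ?_)
    simp only [symDiff₂, hsol.dT_rho ht']
    ring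
  have e2 : dX (dT T u) x t = dX u x t * levySym φ (fun y => ρ y t) x +
      u x t * levySym φ (fun y => dX ρ y t) x -
      levySym φ (fun y => dX (fun x t => ρ x t * u x t) y t) x -
      (dX u x t * dX u x t + u x t * dX (dX u) x t) := by
    have hd := ((((hu.hasDerivAt_dX ht' (x := x)).mul
      (hρ.hasDerivAt_levySym_space h hT ht' (x := x))).sub
      (hρu.hasDerivAt_levySym_space h hT ht' (x := x))).sub
      ((hu.hasDerivAt_dX ht' (x := x)).mul ((hu.space hT).hasDerivAt_dX ht' (x := x)))).deriv
    rw [← hd]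
    unfold dX
    congr 1
    ext y
    exact hsol.dT_vel h hT ht' y
  rw [hu.dT_dX_comm hT ht, e1, e2, vortex]
  ring

theorem rho_nonneg (hT : 0 < T) (hsol : EASol φ T ρ u) (h0 : ∀ x, 0 ≤ ρ x 0) :
    ∀ t ∈ Icc 0 T, ∀ x, 0 ≤ ρ x t := by
  obtain ⟨K, hK⟩ := (hsol.vel.space hT).exists_bound
  refine nonneg_of_transport hT (Hx := dX ρ) (Ht := dT T ρ) (v := u) hsol.smooth_rho.continuousOn
    (fun t _ x => hsol.periodic_rho x t) h0 hK
    (fun t ht x => hsol.rho.hasDerivAt_dX (Ioo_subset_Icc_self ht))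
    (fun t ht x => hsol.rho.hasDerivAt_dT hT ht) fun t ht x => ?_
  have ht' := Ioo_subset_Icc_self ht
  rw [hsol.dT_rho ht', hsol.dX_flux ht']
  ring

/-- The bound `|G| ≤ A ρ` propagates in time. -/
theorem abs_vortex_le (h : A12 φ α a₀ c₁ c₂) (hT : 0 < T) (hsol : EASol φ T ρ u) {A : ℝ}
    (h0 : ∀ x, |vortex φ ρ u x 0| ≤ A * ρ x 0) :
    ∀ t ∈ Icc 0 T, ∀ x, |vortex φ ρ u x t| ≤ A * ρ x t := by
  obtain ⟨K, hK⟩ := (hsol.vel.space hT).exists_bound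
  have hv : ∀ t x, ∃ Gt Gx : ℝ, t ∈ Ioo 0 T →
      HasDerivAt (fun s => vortex φ ρ u x s) Gt t ∧ HasDerivAt (fun y => vortex φ ρ u y t) Gx x ∧
      Gt + u x t * Gx + dX u x t * vortex φ ρ u x t = 0 := fun t x => by
    by_cases ht : t ∈ Ioo 0 T
    · obtain ⟨a, b, hab⟩ := hsol.vortex_transport h hT ht x
      exact ⟨a, b, fun _ => hab⟩
    · exact ⟨0, 0, fun h => absurd h ht⟩
  choose Gt Gx hG using hv
  have key : ∀ σ : ℝ, (∀ x, 0 ≤ A * ρ x 0 + σ * vortex φ ρ u x 0) →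
      ∀ t ∈ Icc 0 T, ∀ x, 0 ≤ A * ρ x t + σ * vortex φ ρ u x t := fun σ hσ => by
    refine nonneg_of_transport hT (Hx := fun x t => A * dX ρ x t + σ * Gx t x)
      (Ht := fun x t => A * dT T ρ x t + σ * Gt t x) (v := u)
      (H := fun x t => A * ρ x t + σ * vortex φ ρ u x t)
      ((continuousOn_const.mul hsol.smooth_rho.continuousOn).add
        (continuousOn_const.mul (hsol.continuousOn_vortex h hT)))
      (fun t _ x => by simp only [hsol.periodic_rho, hsol.vortex_periodic]) hσ hK
      (fun t ht x => ((hsol.rho.hasDerivAt_dX (Ioo_subset_Icc_self ht)).const_mul A).add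
        ((hG t x ht).2.1.const_mul σ))
      (fun t ht x => ((hsol.rho.hasDerivAt_dT hT ht).const_mul A).add
        ((hG t x ht).1.const_mul σ)) fun t ht x => ?_
    have ht' := Ioo_subset_Icc_self ht
    have e := (hG t x ht).2.2
    rw [hsol.dT_rho ht', hsol.dX_flux ht']
    linear_combination σ * e
  intro t ht x
  have k1 := key 1 (fun x => by linarith [(abs_le.1 (h0 x)).1]) t ht x
  have k2 := key (-1) (fun x => by linarith [(abs_le.1 (h0 x)).2]) t ht x
  rw [abs_le]
  constructor <;> linarith

/-- The density stays above the solution of the Riccati equation with right-hand side `-A b² - B b`. -/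
theorem riccati_le_rho (h : A12 φ α a₀ c₁ c₂) (hT : 0 < T) (hsol : EASol φ T ρ u) {A B m : ℝ}
    (hA : 0 ≤ A) (hm : 0 < m) (hmρ : ∀ x, m ≤ ρ x 0) (hB : 0 < B)
    (hBρ : c₂ * (1 + a₀⁻¹) * ∫ x in (-(1:ℝ)/2)..(1/2), ρ x 0 ≤ B)
    (h0 : ∀ x, |vortex φ ρ u x 0| ≤ A * ρ x 0) :
    ∀ t ∈ Icc 0 T, ∀ x, B / ((B * m⁻¹ + A) * Real.exp (B * t) - A) ≤ ρ x t := by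
  have hpos := hsol.rho_nonneg hT fun x => hm.le.trans (hmρ x)
  have hden : ∀ t, 0 ≤ t → 0 < (B * m⁻¹ + A) * Real.exp (B * t) - A := fun t ht => by
    have h1 : 1 ≤ Real.exp (B * t) := Real.one_le_exp (by positivity)
    have h2 : 0 < B * m⁻¹ := by positivity
    nlinarith
  obtain ⟨C, hC⟩ := hsol.rho.exists_bddTwice hT
  have key := nonneg_of_deriv_pos_at_neg_min hT
    (W := fun x t => ρ x t - B / ((B * m⁻¹ + A) * Real.exp (B * t) - A)) ?_ ?_ ?_ ?_
  · exact fun t ht x => sub_nonneg.1 (key t ht x)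
  · refine ContinuousOn.sub hsol.smooth_rho.continuousOn ?_
    refine ContinuousOn.div (f := fun _ : ℝ × ℝ => B)
      (g := fun p : ℝ × ℝ => (B * m⁻¹ + A) * Real.exp (B * p.2) - A)
      continuousOn_const (by fun_prop) fun p hp => (hden p.2 hp.2.1).ne'
  · intro t _ x
    simp only [hsol.periodic_rho]
  · intro x
    have : B / (B * m⁻¹) = m := by field_simp
    simp only [mul_zero, Real.exp_zero, mul_one, add_sub_cancel_right, this, sub_nonneg]
    exact hmρ x
  · intro t ht x hmin hneg
    have ht' := Ioo_subset_Icc_self ht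
    have hD := hden t ht.1.le
    set D := (B * m⁻¹ + A) * Real.exp (B * t) - A with hDdef
    have hρmin : ∀ y, ρ x t ≤ ρ y t := fun y => by linarith [hmin y]
    have hx0 : dX ρ x t = 0 :=
      IsLocalMin.hasDerivAt_eq_zero (Eventually.of_forall hρmin) (hsol.rho.hasDerivAt_dX ht')
    have hDd : HasDerivAt (fun s => (B * m⁻¹ + A) * Real.exp (B * s) - A) (B * (D + A)) t := by
      have h1 : HasDerivAt (fun s => Real.exp (B * s)) (Real.exp (B * t) * B) t := by
        simpa using ((hasDerivAt_id t).const_mul B).exp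
      refine ((h1.const_mul (B * m⁻¹ + A)).sub_const A).congr_deriv ?_
      rw [hDdef]; ring
    refine ⟨_, (hsol.rho.hasDerivAt_dT hT ht).sub ((hasDerivAt_const t B).div hDd hD.ne'), ?_⟩
    have hlevy : levySym φ (fun y => ρ y t) x ≤ B := by
      refine (h.levySym_le_of_isMin (hC t ht') (fun y => hsol.periodic_rho y t) hρmin
        (hpos t ht' x)).trans ?_
      rwa [hsol.rho.mass_conservation hT (hsol.rho.mul hsol.vel)
        (fun x t ht => hsol.dT_rho (Ioo_subset_Icc_self ht) x) ht']
    have hG := (abs_le.1 (hsol.abs_vortex_le h hT h0 t ht' x)).2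
    have hux : dX u x t ≤ A * ρ x t + B := by
      unfold vortex at hG
      linarith
    have hb : (0 * D - B * (B * (D + A))) / D ^ 2 = -(A * (B / D) ^ 2 + B * (B / D)) := by
      field_simp
      ring
    rw [← hDdef, hb, hsol.dT_rho ht', hsol.dX_flux ht', hx0]
    have hr := hpos t ht' x
    have hlt : ρ x t < B / D := sub_neg.1 hneg
    have m1 := mul_le_mul_of_nonneg_left hux hr
    have m2 : A * ρ x t ^ 2 ≤ A * (B / D) ^ 2 := by gcongr
    have m3 : B * ρ x t < B * (B / D) := by gcongr
    nlinarith

end EASol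

/-- (Lower bound on the density.) For a smooth periodic solution with
initially positive density, `ρ(x,t) ≥ M₀ e^{-c₃ ρ̄₀ t}` on `[0,T]`, where
`M₀ = c₃ρ̄₀ / (c₃ρ̄₀ (min ρ₀)⁻¹ + ‖F₀‖_∞) > 0`. In particular no vacuum forms in finite time. -/
theorem stmt3 (φ : ℝ → ℝ) (α a₀ c₁ c₂ : ℝ) (h : A12 φ α a₀ c₁ c₂)
    (T : ℝ) (hT : 0 ≤ T) (ρ u : ℝ → ℝ → ℝ) (hsol : EASol φ T ρ u)
    (hmin : 0 < ⨅ x : ℝ, ρ x 0) :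
    let r₀ := min a₀ ((6 * c₁ * c₂) ^ (-(1 + α)⁻¹))
    let c₃ := c₁ * r₀ ^ (-(1 + α)) + c₂ * (1 + a₀⁻¹)
    let ρbar := ∫ x in (-(1:ℝ)/2)..(1/2), ρ x 0
    let F₀ := fun x : ℝ => (deriv (fun y => u y 0) x - levy φ (fun y => ρ y 0) x) / ρ x 0
    let M₀ := c₃ * ρbar / (c₃ * ρbar * (⨅ x : ℝ, ρ x 0)⁻¹ + supNorm F₀)
    0 < M₀ ∧ ∀ x : ℝ, ∀ t ∈ Set.Icc 0 T, M₀ * Real.exp (-(c₃ * ρbar * t)) ≤ ρ x t := by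
  intro r₀ c₃ ρbar F₀ M₀
  have ha := h.a₀pos
  have hc₁ := h.c₁ge
  have hc₂ := h.c₂pos
  have hr₀ : 0 < r₀ := lt_min ha (by positivity)
  have hκ : c₂ * (1 + a₀⁻¹) ≤ c₃ := by
    have : 0 ≤ c₁ * r₀ ^ (-(1 + α)) := by positivity
    simp only [c₃]; linarith
  have hc₃ : 0 < c₃ := lt_of_lt_of_le (by positivity) hκ
  set m := ⨅ x : ℝ, ρ x 0 with hm
  have hbelow : BddBelow (range fun x => ρ x 0) := by
    by_contra hb
    rw [hm, Real.iInf_of_not_bddBelow hb] at hmin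
    exact lt_irrefl _ hmin
  have hmρ : ∀ x, m ≤ ρ x 0 := fun x => ciInf_le hbelow x
  have hρ0 : Continuous fun x => ρ x 0 :=
    hsol.smooth_rho.continuousOn.comp_continuous (f := fun x : ℝ => (x, (0:ℝ))) (by fun_prop)
      fun x => ⟨mem_univ _, le_rfl, hT⟩
  have hρbar : 0 < ρbar := intervalIntegral.intervalIntegral_pos_of_pos
    (hρ0.intervalIntegrable _ _) (fun x => hmin.trans_le (hmρ x)) (by norm_num)
  have hB : 0 < c₃ * ρbar := mul_pos hc₃ hρbar
  have hA : 0 ≤ supNorm F₀ := Real.iSup_nonneg fun x => abs_nonneg _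
  have hden : 0 < c₃ * ρbar * m⁻¹ + supNorm F₀ := by positivity
  refine ⟨div_pos hB hden, fun x t ht => ?_⟩
  rcases hT.eq_or_lt with hT0 | hTpos
  · have ht0 : t = 0 := le_antisymm (ht.2.trans hT0.ge) ht.1
    subst ht0
    refine le_trans ?_ (hmρ x)
    simp only [mul_zero, neg_zero, Real.exp_zero, mul_one, M₀]
    rw [div_le_iff₀ hden]
    have : m * (c₃ * ρbar * m⁻¹) = c₃ * ρbar := by field_simp
    nlinarith
  · have h0mem : (0:ℝ) ∈ Icc 0 T := ⟨le_rfl, hT⟩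
    obtain ⟨C, hC⟩ := hsol.rho.exists_bddTwice hTpos
    have hF : ∀ x, F₀ x = EASol.vortex φ ρ u x 0 / ρ x 0 := fun x => by
      simp only [F₀, EASol.vortex, dX, h.levy_eq (hC 0 h0mem)]
    obtain ⟨CG, hCG⟩ := exists_bound_of_continuousOn_strip (hsol.continuousOn_vortex h hTpos)
      fun t _ x => hsol.vortex_periodic x t
    have hFbdd : BddAbove (range fun x => |F₀ x|) := by
      refine ⟨CG / m, ?_⟩
      rintro _ ⟨x, rfl⟩
      have hG := hCG 0 h0mem x
      simp only [hF, abs_div]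
      rw [abs_of_pos (hmin.trans_le (hmρ x))]
      exact div_le_div₀ ((abs_nonneg _).trans hG) hG hmin (hmρ x)
    have h0 : ∀ x, |EASol.vortex φ ρ u x 0| ≤ supNorm F₀ * ρ x 0 := fun x => by
      have hp : 0 < ρ x 0 := hmin.trans_le (hmρ x)
      have : |F₀ x| ≤ supNorm F₀ := le_ciSup hFbdd x
      rwa [hF, abs_div, abs_of_pos hp, div_le_iff₀ hp] at this
    refine le_trans ?_ (hsol.riccati_le_rho h hTpos hA hmin hmρ hB
      (mul_le_mul_of_nonneg_right hκ hρbar.le) h0 t ht x)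
    have hexp : 1 ≤ Real.exp (c₃ * ρbar * t) := Real.one_le_exp (mul_nonneg hB.le ht.1)
    have hBm : 0 < c₃ * ρbar * m⁻¹ := by positivity
    rw [Real.exp_neg, ← div_eq_mul_inv, div_div]
    exact div_le_div_of_nonneg_left hB.le (by nlinarith) (by linarith)
end
end

section
/- Let φ satisfy assumptions (A1)–(A2) with α ∈ (0,2), let ω be a modulus of continuity (continuous, nondecreasing, concave, piecewise C² on (0,∞)), and let ρ : ℝ → ℝ be a smooth 1-periodic function with |ρ(a)−ρ(b)| ≤ ω(|a−b|) for all a,b. Suppose x ≠ y satisfy ρ(x) − ρ(y) = ω(ξ) with ξ := |x−y| ∈ (0, a₀/2]. Define D(x,y) := 𝓛ρ(x) − 𝓛ρ(y) = p.v. ∫_ℝ φ(z)( ω(ξ) − ρ(x+z) + ρ(y+z) ) dz and D₁(x,y) := p.v. ∫_{|z|≤a₀} φ(z)( ω(ξ) − ρ(x+z) + ρ(y+z) ) dz. Then D(x,y) ≥ D₁(x,y) − 2c₂ ω(ξ), and D₁(x,y) ≥ (1/c₁) ∫₀^{ξ/2} (2ω(ξ) − ω(ξ+2η) − ω(ξ−2η))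 η^{−(1+α)} dη + (1/c₁) ∫_{ξ/2}^{a₀} (2ω(ξ) − ω(2η+ξ) + ω(2η−ξ)) η^{−(1+α)} dη. -/
open Real MeasureTheory Filter Set Topology

noncomputable section

/-- A modulus of continuity: positive, continuous, nondecreasing and concave on `(0,∞)`. -/
structure IsMOC (ω : ℝ → ℝ) : Prop where
  pos : ∀ ξ : ℝ, 0 < ξ → 0 < ω ξ
  cont : ContinuousOn ω (Set.Ioi 0)
  mono : MonotoneOn ω (Set.Ioi 0)
  concave : ConcaveOn ℝ (Set.Ioi 0) ω


theorem ContDiff.exists_abs_symm_diff_le {f : ℝ → ℝ} (hf : ContDiff ℝ 2 f) (x a : ℝ) :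
    ∃ C, 0 ≤ C ∧ ∀ s ∈ Ioc 0 a, |f (x + s) + f (x - s) - 2 * f x| ≤ C * s ^ 2 := by
  have hd : Differentiable ℝ f := hf.differentiable (by norm_num)
  have hf' : ContDiff ℝ 1 (deriv f) := by
    simpa using ContDiff.iterate_deriv' 1 1 (f := f) (by simpa using hf)
  have hd' : Differentiable ℝ (deriv f) := hf'.differentiable (by norm_num)
  obtain ⟨M, hM⟩ := (isCompact_Icc (a := x - a) (b := x + a)).exists_bound_of_continuousOn
    (hf'.continuous_deriv le_rfl).continuousOn
  have hM' : ∀ z ∈ Icc (x - a) (x + a), ‖deriv (deriv f) z‖ ≤ |M| :=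
    fun z hz => (hM z hz).trans (le_abs_self M)
  refine ⟨2 * |M|, by positivity, fun s hs => ?_⟩
  have hlip : ∀ r ∈ Icc 0 s, ‖deriv f (x + r) - deriv f (x - r)‖ ≤ 2 * |M| * s := by
    intro r hr
    have := (convex_Icc (x - a) (x + a)).norm_image_sub_le_of_norm_deriv_le
      (fun z _ => hd' z) hM' (x := x - r) (y := x + r)
      ⟨by linarith [hr.1, hr.2, hs.2], by linarith [hr.1, hr.2, hs.2, hs.1]⟩
      ⟨by linarith [hr.1, hr.2, hs.2], by linarith [hr.1, hr.2, hs.2]⟩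
    refine this.trans ?_
    rw [show x + r - (x - r) = 2 * r by ring, Real.norm_eq_abs,
      abs_of_nonneg (show 0 ≤ 2 * r by linarith [hr.1])]
    nlinarith [abs_nonneg M, hr.2]
  have hder : ∀ r ∈ Icc 0 s, HasDerivWithinAt (fun r => f (x + r) + f (x - r))
      (deriv f (x + r) - deriv f (x - r)) (Icc 0 s) r := by
    intro r _
    have h₁ : HasDerivAt (fun r => f (x + r)) (deriv f (x + r)) r := by
      exact (hd (x + r)).hasDerivAt.comp_const_add x r
    have h₂ : HasDerivAt (fun r => f (x - r)) (-deriv f (x - r)) r := by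
      exact (hd (x - r)).hasDerivAt.comp_const_sub x r
    exact (h₁.add h₂).hasDerivWithinAt
  have := (convex_Icc 0 s).norm_image_sub_le_of_norm_hasDerivWithin_le hder hlip
    (left_mem_Icc.2 hs.1.le) (right_mem_Icc.2 hs.1.le)
  simp only [add_zero, sub_zero, Real.norm_eq_abs, abs_of_pos hs.1] at this
  calc _ = |f (x + s) + f (x - s) - (f x + f x)| := by ring_nf
    _ ≤ _ := this
    _ = _ := by ring

theorem intervalIntegrable_of_abs_le {f g : ℝ → ℝ} {a b : ℝ} (hab : a ≤ b)
    (hf : ContinuousOn f (Ioo a b)) (hg : IntervalIntegrable g volume a b)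
    (hfg : ∀ s ∈ Ioo a b, |f s| ≤ g s) : IntervalIntegrable f volume a b := by
  rw [intervalIntegrable_iff_integrableOn_Ioo_of_le hab] at hg ⊢
  refine Integrable.mono' hg (hf.aestronglyMeasurable measurableSet_Ioo) ?_
  filter_upwards [ae_restrict_mem measurableSet_Ioo] with s hs using hfg s hs

theorem intervalIntegral_mono_of_nonneg {f g : ℝ → ℝ} {a b : ℝ} (hab : a ≤ b)
    (hg : IntervalIntegrable g volume a b) (hf : ∀ s ∈ Ioo a b, 0 ≤ f s)
    (hfg : ∀ s ∈ Ioo a b, f s ≤ g s) : ∫ s in a..b, f s ≤ ∫ s in a..b, g s := by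
  rw [intervalIntegrable_iff_integrableOn_Ioo_of_le hab] at hg
  rw [intervalIntegral.integral_of_le hab, intervalIntegral.integral_of_le hab,
    integral_Ioc_eq_integral_Ioo, integral_Ioc_eq_integral_Ioo]
  refine integral_mono_of_nonneg ?_ hg ?_
  · filter_upwards [ae_restrict_mem measurableSet_Ioo] with s hs using hf s hs
  · filter_upwards [ae_restrict_mem measurableSet_Ioo] with s hs using hfg s hs

/-- Reflection inequality for a decreasing kernel `k` and a nonnegative function `g`. -/
theorem integral_mul_reflection_le {k g : ℝ → ℝ} {a b : ℝ} (hb : 0 < b) (hba : 2 * b ≤ a)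
    (hk0 : ∀ s ∈ Ioc 0 a, 0 ≤ k s) (hk : AntitoneOn k (Ioc 0 a)) (hg : ∀ t, 0 < t → 0 ≤ g t)
    (h₁ : IntervalIntegrable (fun s => k s * g (b - s)) volume 0 b)
    (h₂ : IntervalIntegrable (fun s => k s * g (b + s)) volume 0 a)
    (h₃ : IntervalIntegrable (fun s => k s * g (s - b)) volume b a) :
    ∫ s in b..a, k s * g (s - b) ≤
      (∫ s in 0..b, k s * g (b - s)) + ∫ s in 0..a, k s * g (b + s) := by
  have h₃l : IntervalIntegrable (fun s => k s * g (s - b)) volume b (2 * b) :=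
    h₃.mono_set (by
      rw [uIcc_of_le (by linarith), uIcc_of_le (by linarith)]; exact Icc_subset_Icc_right hba)
  have h₃r : IntervalIntegrable (fun s => k s * g (s - b)) volume (2 * b) a :=
    h₃.mono_set (by
      rw [uIcc_of_le (by linarith), uIcc_of_le (by linarith)]
      exact Icc_subset_Icc_left (by linarith))
  have h₂l : IntervalIntegrable (fun s => k s * g (b + s)) volume 0 (a - 2 * b) :=
    h₂.mono_set (by
      rw [uIcc_of_le (by linarith), uIcc_of_le (by linarith)]
      exact Icc_subset_Icc_right (by linarith))
  have h₂r : IntervalIntegrable (fun s => k s * g (b + s)) volume (a - 2 * b) a :=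
    h₂.mono_set (by
      rw [uIcc_of_le (by linarith), uIcc_of_le (by linarith)]
      exact Icc_subset_Icc_left (by linarith))
  rw [← intervalIntegral.integral_add_adjacent_intervals h₃l h₃r,
    ← intervalIntegral.integral_add_adjacent_intervals h₂l h₂r]
  have hl : ∫ s in b..2 * b, k s * g (s - b) ≤ ∫ s in 0..b, k s * g (b - s) := by
    have e := intervalIntegral.integral_comp_sub_left (a := 0) (b := b)
      (fun s => k s * g (s - b)) (2 * b)
    rw [show 2 * b - b = b by ring, sub_zero] at e
    rw [← e]
    refine intervalIntegral_mono_of_nonneg hb.le h₁ (fun s hs => ?_) (fun s hs => ?_)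
    · exact mul_nonneg (hk0 _ ⟨by linarith [hs.2], by linarith [hs.1]⟩)
        (hg _ (by linarith [hs.2]))
    · rw [show 2 * b - s - b = b - s by ring]
      exact mul_le_mul_of_nonneg_right (hk ⟨hs.1, by linarith [hs.2]⟩
        ⟨by linarith [hs.2], by linarith [hs.1]⟩ (by linarith [hs.2])) (hg _ (by linarith [hs.2]))
  have hm : ∫ s in 2 * b..a, k s * g (s - b) ≤ ∫ s in 0..(a - 2 * b), k s * g (b + s) := by
    have e := intervalIntegral.integral_comp_add_right (a := 0) (b := a - 2 * b)
      (fun s => k s * g (s - b)) (2 * b)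
    rw [sub_add_cancel, zero_add] at e
    rw [← e]
    refine intervalIntegral_mono_of_nonneg (by linarith) h₂l (fun s hs => ?_) (fun s hs => ?_)
    · exact mul_nonneg (hk0 _ ⟨by linarith [hs.1], by linarith [hs.2]⟩)
        (hg _ (by linarith [hs.1]))
    · rw [show s + 2 * b - b = b + s by ring]
      exact mul_le_mul_of_nonneg_right (hk ⟨hs.1, by linarith [hs.2]⟩
        ⟨by linarith [hs.1], by linarith [hs.2]⟩ (by linarith)) (hg _ (by linarith [hs.1]))
  have hr : 0 ≤ ∫ s in (a - 2 * b)..a, k s * g (b + s) := by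
    have := intervalIntegral_mono_of_nonneg (f := fun _ => 0) (by linarith) h₂r
      (fun _ _ => le_rfl) (fun s hs => mul_nonneg (hk0 s ⟨by linarith [hs.1], hs.2.le⟩)
        (hg _ (by linarith [hs.1])))
    simpa using this
  linarith

theorem setIntegral_annulus {f : ℝ → ℝ} {ε a : ℝ} (hε : 0 < ε) (hεa : ε ≤ a)
    (hf : ContinuousOn f {0}ᶜ) :
    ∫ z in {z : ℝ | ε ≤ |z| ∧ |z| ≤ a}, f z = ∫ z in ε..a, (f z + f (-z)) := by
  have hset : {z : ℝ | ε ≤ |z| ∧ |z| ≤ a} = Icc (-a) (-ε) ∪ Icc ε a := by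
    ext z
    simp only [mem_ofPred_eq, mem_union, mem_Icc]
    rcases abs_cases z with ⟨e, _⟩ | ⟨e, _⟩ <;> rw [e] <;> constructor
    · exact fun h => Or.inr h
    · rintro (h | h) <;> constructor <;> linarith [h.1, h.2]
    · exact fun h => Or.inl ⟨by linarith [h.2], by linarith [h.1]⟩
    · rintro (h | h) <;> constructor <;> linarith [h.1, h.2]
  have hp : ContinuousOn f (Icc ε a) :=
    hf.mono fun z hz => by simpa using (hε.trans_le hz.1).ne'
  have hn : ContinuousOn f (Icc (-a) (-ε)) :=
    hf.mono fun z hz => by simpa using (show z < 0 by linarith [hz.2]).ne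
  have hn' : ContinuousOn (fun z => f (-z)) (Icc ε a) :=
    hn.comp continuousOn_neg fun z hz => ⟨by linarith [hz.2], by linarith [hz.1]⟩
  have hdisj : Disjoint (Icc (-a) (-ε)) (Icc ε a) :=
    disjoint_left.2 fun z h₁ h₂ => by linarith [h₁.2, h₂.1]
  rw [hset, setIntegral_union hdisj measurableSet_Icc hn.integrableOn_Icc hp.integrableOn_Icc,
    intervalIntegral.integral_add (hp.intervalIntegrable_of_Icc hεa)
      (hn'.intervalIntegrable_of_Icc hεa), intervalIntegral.integral_comp_neg,
    intervalIntegral.integral_of_le hεa, intervalIntegral.integral_of_le (neg_le_neg hεa),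
    integral_Icc_eq_integral_Ioc, integral_Icc_eq_integral_Ioc, add_comm]

theorem tendsto_setIntegral_annulus {f : ℝ → ℝ} {a : ℝ} (ha : 0 < a)
    (hf : ContinuousOn f {0}ᶜ)
    (hi : IntervalIntegrable (fun z => f z + f (-z)) volume 0 a) :
    Tendsto (fun ε => ∫ z in {z : ℝ | ε ≤ |z| ∧ |z| ≤ a}, f z) (𝓝[>] 0)
      (𝓝 (∫ z in 0..a, (f z + f (-z)))) := by
  have hev : ∀ᶠ ε in 𝓝[>] (0 : ℝ), ε ∈ Ioc 0 a := Ioc_mem_nhdsGT ha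
  have hc := intervalIntegral.continuousOn_primitive_interval_left
    ((intervalIntegrable_iff' (by finiteness)).1 hi) 0 left_mem_uIcc
  rw [uIcc_of_le ha.le] at hc
  have hle : 𝓝[>] (0 : ℝ) ≤ 𝓝[Icc 0 a] 0 :=
    nhdsWithin_le_of_mem (mem_of_superset (Ioc_mem_nhdsGT ha) Ioc_subset_Icc_self)
  refine (hc.tendsto.mono_left hle).congr' ?_
  filter_upwards [hev] with ε hε using (setIntegral_annulus hε.1 hε.2 hf).symm

theorem integrableOn_abs_ge {f : ℝ → ℝ} {ε a : ℝ} (hε : 0 < ε) (hf : ContinuousOn f {0}ᶜ)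
    (ht : IntegrableOn f {z | a < |z|}) : IntegrableOn f {z : ℝ | ε ≤ |z|} := by
  have hK : IsCompact {z : ℝ | ε ≤ |z| ∧ |z| ≤ a} := by
    refine (isCompact_Icc (a := -a) (b := a)).of_isClosed_subset ?_ fun z hz => abs_le.1 hz.2
    exact (isClosed_le continuous_const continuous_abs).inter
      (isClosed_le continuous_abs continuous_const)
  have hc : ContinuousOn f {z : ℝ | ε ≤ |z| ∧ |z| ≤ a} :=
    hf.mono fun z hz => by simpa using abs_pos.1 (hε.trans_le hz.1)
  refine ((hc.integrableOn_compact hK).union ht).mono_set fun z hz => ?_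
  rcases le_or_gt |z| a with h | h
  · exact Or.inl ⟨hz, h⟩
  · exact Or.inr h

theorem tendsto_setIntegral_abs_ge {f : ℝ → ℝ} {a : ℝ} (ha : 0 < a)
    (hf : ContinuousOn f {0}ᶜ) (ht : IntegrableOn f {z | a < |z|})
    (hi : IntervalIntegrable (fun z => f z + f (-z)) volume 0 a) :
    Tendsto (fun ε => ∫ z in {z : ℝ | ε ≤ |z|}, f z) (𝓝[>] 0)
      (𝓝 ((∫ z in 0..a, (f z + f (-z))) + ∫ z in {z : ℝ | a < |z|}, f z)) := by
  have hev : ∀ᶠ ε in 𝓝[>] (0 : ℝ), ε ∈ Ioc 0 a := Ioc_mem_nhdsGT ha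
  refine ((tendsto_setIntegral_annulus ha hf hi).add_const _).congr' ?_
  filter_upwards [hev] with ε hε
  have hset : {z : ℝ | ε ≤ |z|} = {z : ℝ | ε ≤ |z| ∧ |z| ≤ a} ∪ {z | a < |z|} := by
    ext z
    simp only [mem_ofPred_eq, mem_union]
    constructor
    · exact fun h => (le_or_gt |z| a).imp (fun h' => ⟨h, h'⟩) id
    · rintro (h | h)
      · exact h.1
      · exact hε.2.trans h.le
  have hI := integrableOn_abs_ge hε.1 hf ht
  have hdisj : Disjoint {z : ℝ | ε ≤ |z| ∧ |z| ≤ a} {z | a < |z|} :=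
    disjoint_left.2 fun z h₁ h₂ => absurd h₂ (not_lt.2 h₁.2)
  have hmeas : MeasurableSet {z : ℝ | a < |z|} :=
    measurableSet_lt measurable_const continuous_abs.measurable
  rw [hset, setIntegral_union hdisj hmeas (hI.mono_set fun z hz => hz.1) ht]

theorem IsMOC.mul_div_le {ω : ℝ → ℝ} (hω : IsMOC ω) {u s : ℝ} (hu : 0 < u) (hus : u < s) :
    u / s * ω s ≤ ω u := by
  have hs : 0 < s := hu.trans hus
  have hlim : Tendsto (fun ε : ℝ => (u - ε) / (s - ε) * ω s) (𝓝[>] 0) (𝓝 (u / s * ω s)) := by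
    have : ContinuousAt (fun ε : ℝ => (u - ε) / (s - ε) * ω s) 0 := by
      have : s - 0 ≠ 0 := by simpa using hs.ne'
      fun_prop (disch := assumption)
    simpa using this.tendsto.mono_left nhdsWithin_le_nhds
  refine le_of_tendsto hlim ?_
  filter_upwards [Ioo_mem_nhdsGT hu] with ε hε
  have hsε : 0 < s - ε := by linarith [hε.2]
  have hc := hω.concave.2 (mem_Ioi.2 hε.1) (mem_Ioi.2 hs)
    (show 0 ≤ (s - u) / (s - ε) from div_nonneg (by linarith) hsε.le)
    (show 0 ≤ (u - ε) / (s - ε) from div_nonneg (by linarith [hε.2]) hsε.le)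
    (by field_simp; ring)
  have he : (s - u) / (s - ε) * ε + (u - ε) / (s - ε) * s = u := by field_simp; ring
  simp only [smul_eq_mul, he] at hc
  have := mul_nonneg (div_nonneg (show 0 ≤ s - u by linarith) hsε.le) (hω.pos ε hε.1).le
  linarith

theorem IsMOC.add_le {ω : ℝ → ℝ} (hω : IsMOC ω) {u v : ℝ} (hu : 0 < u) (hv : 0 < v) :
    ω (u + v) ≤ ω u + ω v := by
  have h₁ := hω.mul_div_le hu (show u < u + v by linarith)
  have h₂ := hω.mul_div_le hv (show v < u + v by linarith)
  have : u / (u + v) * ω (u + v) + v / (u + v) * ω (u + v) = ω (u + v) := by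
    field_simp
  linarith

theorem IsMOC.add_sub_le {ω : ℝ → ℝ} (hω : IsMOC ω) {b s : ℝ} (hs : 0 < s) (hsb : s < b) :
    ω (2 * (b + s)) + ω (2 * (b - s)) ≤ 2 * ω (2 * b) := by
  have hc := hω.concave.2 (mem_Ioi.2 (show 0 < 2 * (b + s) by linarith))
    (mem_Ioi.2 (show 0 < 2 * (b - s) by linarith)) (show (0 : ℝ) ≤ 1 / 2 by norm_num)
    (show (0 : ℝ) ≤ 1 / 2 by norm_num) (by norm_num)
  simp only [smul_eq_mul] at hc
  rw [show 1 / 2 * (2 * (b + s)) + 1 / 2 * (2 * (b - s)) = 2 * b by ring] at hc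
  linarith

theorem IsMOC.sub_le {ω : ℝ → ℝ} (hω : IsMOC ω) {b s : ℝ} (hb : 0 < b) (hbs : b < s) :
    ω (2 * (b + s)) - ω (2 * (s - b)) ≤ 2 * ω (2 * b) := by
  have h₁ := hω.add_le (u := 2 * (s - b)) (v := 2 * b + 2 * b) (by linarith) (by linarith)
  have h₂ := hω.add_le (u := 2 * b) (v := 2 * b) (by linarith) (by linarith)
  rw [show 2 * (s - b) + (2 * b + 2 * b) = 2 * (b + s) by ring] at h₁
  linarith

namespace A12

variable {φ : ℝ → ℝ} {α a₀ c₁ c₂ : ℝ}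

theorem nonneg_s14 (h : A12 φ α a₀ c₁ c₂) {s : ℝ} (hs : s ∈ Ioc 0 a₀) : 0 ≤ φ s := by
  have hc : 0 < c₁ := by linarith [h.c₁ge]
  refine le_trans ?_ (h.lower s hs.1.ne' (by rw [abs_of_pos hs.1]; exact hs.2))
  positivity

theorem antitoneOn (h : A12 φ α a₀ c₁ c₂) : AntitoneOn φ (Ioc 0 a₀) :=
  fun r hr s hs hrs => h.mono r s hr.1 hrs hs.2

theorem tail_integrable (h : A12 φ α a₀ c₁ c₂) : IntegrableOn φ {z | a₀ < |z|} := by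
  have hsub : {z : ℝ | a₀ < |z|} ⊆ {z | a₀ ≤ |z|} := fun z (hz : a₀ < |z|) => hz.le
  have hi := (h.tailInt 0 (by norm_num)).mono_set hsub
  have hm : MeasurableSet {z : ℝ | a₀ < |z|} :=
    measurableSet_lt measurable_const continuous_abs.measurable
  refine Integrable.mono' hi ((h.smooth.continuousOn.mono fun z hz => ?_).aestronglyMeasurable hm)
    (Eventually.of_forall fun z => by simp)
  simpa using abs_pos.1 (h.a₀pos.trans hz)

theorem tail_bound (h : A12 φ α a₀ c₁ c₂) : ∫ z in {z | a₀ < |z|}, |φ z| ≤ c₂ := by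
  have hb := h.tailBound 0 (by norm_num)
  have hi := h.tailInt 0 (by norm_num)
  simp only [Nat.cast_zero, rpow_zero, one_mul, iteratedDeriv_zero] at hb hi
  exact (setIntegral_mono_set hi (Eventually.of_forall fun z => abs_nonneg _)
    (Eventually.of_forall fun z hz => le_of_lt hz)).trans hb

theorem continuousOn_mul (h : A12 φ α a₀ c₁ c₂) {F : ℝ → ℝ} (hF : Continuous F) :
    ContinuousOn (fun z => φ z * F z) {0}ᶜ :=
  h.smooth.continuousOn.mul hF.continuousOn

theorem tail_integrable_mul (h : A12 φ α a₀ c₁ c₂) {F : ℝ → ℝ} (hF : Continuous F) {B : ℝ}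
    (hB : ∀ z, |F z| ≤ B) : IntegrableOn (fun z => φ z * F z) {z | a₀ < |z|} :=
  Integrable.mul_bdd (c := B) h.tail_integrable hF.aestronglyMeasurable (Eventually.of_forall hB)

theorem intervalIntegrable_mul (h : A12 φ α a₀ c₁ c₂) {G : ℝ → ℝ} (hG : Continuous G) {C : ℝ}
    (hC : ∀ s ∈ Ioc 0 a₀, |G s| ≤ C * s ^ 2) :
    IntervalIntegrable (fun s => φ s * G s) volume 0 a₀ := by
  have hr : IntervalIntegrable (fun s : ℝ => s ^ (1 - α)) volume 0 a₀ :=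
    intervalIntegral.intervalIntegrable_rpow' (by linarith [h.αlt])
  refine intervalIntegrable_of_abs_le h.a₀pos.le ((h.continuousOn_mul hG).mono fun s hs => ?_)
    (hr.const_mul (c₁ * C)) fun s hs => ?_
  · simpa using hs.1.ne'
  · have hs' : s ∈ Ioc 0 a₀ := ⟨hs.1, hs.2.le⟩
    have hu := h.upper s hs.1.ne' (by rw [abs_of_pos hs.1]; exact hs.2.le)
    rw [abs_of_pos hs.1] at hu
    rw [abs_mul, abs_of_nonneg (h.nonneg_s14 hs')]
    calc φ s * |G s| ≤ (c₁ * s ^ (-(1 + α))) * (C * s ^ 2) :=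
          mul_le_mul hu (hC s hs') (abs_nonneg _) ((h.nonneg_s14 hs').trans hu)
      _ = c₁ * C * (s ^ (-(1 + α)) * s ^ (2 : ℝ)) := by rw [rpow_two]; ring
      _ = c₁ * C * s ^ (1 - α) := by
          rw [← rpow_add hs.1]; congr 2; ring

theorem intervalIntegrable_symm (h : A12 φ α a₀ c₁ c₂) {F : ℝ → ℝ} (hF : Continuous F) {C : ℝ}
    (hC : ∀ s ∈ Ioc 0 a₀, |F s + F (-s)| ≤ C * s ^ 2) :
    IntervalIntegrable (fun s => φ s * F s + φ (-s) * F (-s)) volume 0 a₀ := by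
  simp only [h.even, ← mul_add]
  exact h.intervalIntegrable_mul (G := fun s => F s + F (-s)) (by fun_prop) hC

theorem one_div_mul_div_le (h : A12 φ α a₀ c₁ c₂) {s w : ℝ} (hs : s ∈ Ioc 0 a₀) (hw : 0 ≤ w) :
    1 / c₁ * (w / s ^ (1 + α)) ≤ φ s * w := by
  have hl := h.lower s hs.1.ne' (by rw [abs_of_pos hs.1]; exact hs.2)
  rw [abs_of_pos hs.1, rpow_neg hs.1.le] at hl
  calc 1 / c₁ * (w / s ^ (1 + α)) = c₁⁻¹ * (s ^ (1 + α))⁻¹ * w := by ring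
    _ ≤ φ s * w := mul_le_mul_of_nonneg_right hl hw

theorem integral_one_div_mul_div_le (h : A12 φ α a₀ c₁ c₂) {W : ℝ → ℝ} {u v : ℝ} (hu : 0 ≤ u)
    (huv : u ≤ v) (hv : v ≤ a₀) (hW : ∀ s ∈ Ioo u v, 0 ≤ W s)
    (hi : IntervalIntegrable (fun s => φ s * W s) volume u v) :
    1 / c₁ * ∫ s in u..v, W s / s ^ (1 + α) ≤ ∫ s in u..v, φ s * W s := by
  have hc : 0 < c₁ := by linarith [h.c₁ge]
  rw [← intervalIntegral.integral_const_mul]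
  refine intervalIntegral_mono_of_nonneg huv hi (fun s hs => ?_) fun s hs =>
    h.one_div_mul_div_le ⟨hu.trans_lt hs.1, hs.2.le.trans hv⟩ (hW s hs)
  have := hW s hs
  have : 0 < s := hu.trans_lt hs.1
  positivity

/-- Lower bound for the symmetrised short-range dissipation; `p` is the density along the line
through the pair, centred at the midpoint, and `2 * b` is the distance of the pair. -/
theorem short_range_lower_bound (h : A12 φ α a₀ c₁ c₂) {ω : ℝ → ℝ} (hω : IsMOC ω) {p : ℝ → ℝ}
    (hp : Continuous p) (hob : ∀ t, 0 < t → |p t - p (-t)| ≤ ω (2 * t)) {b : ℝ} (hb : 0 < b)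
    (hba : 2 * b ≤ a₀)
    (hG : IntervalIntegrable (fun s => φ s *
      (2 * ω (2 * b) - p (b + s) - p (b - s) + p (-(b - s)) + p (-(b + s)))) volume 0 a₀) :
    1 / c₁ * (∫ s in 0..b,
        (2 * ω (2 * b) - ω (2 * (b + s)) - ω (2 * (b - s))) / s ^ (1 + α)) +
      1 / c₁ * (∫ s in b..a₀,
        (2 * ω (2 * b) - ω (2 * (b + s)) + ω (2 * (s - b))) / s ^ (1 + α)) ≤
      ∫ s in 0..a₀, φ s *
        (2 * ω (2 * b) - p (b + s) - p (b - s) + p (-(b - s)) + p (-(b + s))) := by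
  have hba' : b < a₀ := by linarith
  set g : ℝ → ℝ := fun t => ω (2 * t) - (p t - p (-t)) with hgdef
  have hg0 : ∀ t, 0 < t → 0 ≤ g t := fun t ht => sub_nonneg.2 ((le_abs_self _).trans (hob t ht))
  have hg2 : ∀ t, 0 < t → g t ≤ 2 * ω (2 * t) := fun t ht => by
    have := (abs_le.1 (hob t ht)).1
    simp only [hgdef]; linarith
  have hωc : ∀ {q : ℝ → ℝ} {S : Set ℝ}, Continuous q → (∀ s ∈ S, 0 < q s) →
      ContinuousOn (fun s => ω (2 * q s)) S := fun {q S} hq hpos =>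
    hω.cont.comp (by fun_prop) fun s hs => mem_Ioi.2 (by linarith [hpos s hs])
  have hgc : ∀ {q : ℝ → ℝ} {S : Set ℝ}, Continuous q → (∀ s ∈ S, 0 < q s) →
      ContinuousOn (fun s => g (q s)) S := fun {q S} hq hpos =>
    (hωc hq hpos).sub (by fun_prop)
  have hφc : ∀ {S : Set ℝ}, (∀ s ∈ S, 0 < s) → ContinuousOn φ S := fun hpos =>
    h.smooth.continuousOn.mono fun s hs => by simpa using (hpos s hs).ne'
  set W₁ : ℝ → ℝ := fun s => 2 * ω (2 * b) - ω (2 * (b + s)) - ω (2 * (b - s)) with hW₁def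
  set W₂ : ℝ → ℝ := fun s => 2 * ω (2 * b) - ω (2 * (b + s)) + ω (2 * (s - b)) with hW₂def
  set G : ℝ → ℝ := fun s =>
    2 * ω (2 * b) - p (b + s) - p (b - s) + p (-(b - s)) + p (-(b + s)) with hGdef
  have hW₁0 : ∀ s ∈ Ioo 0 b, 0 ≤ W₁ s := fun s hs => by
    have := hω.add_sub_le hs.1 hs.2
    simp only [hW₁def]; linarith
  have hW₂0 : ∀ s ∈ Ioo b a₀, 0 ≤ W₂ s := fun s hs => by
    have := hω.sub_le hb hs.1
    simp only [hW₂def]; linarith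
  have hG₁ : ∀ s, G s = W₁ s + g (b + s) + g (b - s) := fun s => by
    simp only [hGdef, hW₁def, hgdef]; ring
  have hG₂ : ∀ s, G s = W₂ s + g (b + s) - g (s - b) := fun s => by
    simp only [hGdef, hW₂def, hgdef, neg_sub]; ring
  have hGl : IntervalIntegrable (fun s => φ s * G s) volume 0 b := hG.mono_set (by
    rw [uIcc_of_le hb.le, uIcc_of_le h.a₀pos.le]; exact Icc_subset_Icc_right hba'.le)
  have hGr : IntervalIntegrable (fun s => φ s * G s) volume b a₀ := hG.mono_set (by
    rw [uIcc_of_le hba'.le, uIcc_of_le h.a₀pos.le]; exact Icc_subset_Icc_left hb.le)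
  have hdom : ∀ {f : ℝ → ℝ}, ContinuousOn f (Ioo 0 b) → (∀ s ∈ Ioo 0 b, 0 ≤ f s) →
      (∀ s ∈ Ioo 0 b, f s ≤ G s) → IntervalIntegrable (fun s => φ s * f s) volume 0 b := by
    intro f hf hf0 hfG
    refine intervalIntegrable_of_abs_le hb.le ((hφc fun s hs => hs.1).mul hf) hGl fun s hs => ?_
    have hφ0 := h.nonneg_s14 (s := s) ⟨hs.1, hs.2.le.trans hba'.le⟩
    rw [abs_of_nonneg (mul_nonneg hφ0 (hf0 s hs))]
    exact mul_le_mul_of_nonneg_left (hfG s hs) hφ0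
  have hbdd : ∀ {f : ℝ → ℝ} {B : ℝ}, ContinuousOn f (Ioo b a₀) → (∀ s ∈ Ioo b a₀, 0 ≤ f s) →
      (∀ s ∈ Ioo b a₀, f s ≤ B) → IntervalIntegrable (fun s => φ s * f s) volume b a₀ := by
    intro f B hf hf0 hfB
    refine intervalIntegrable_of_abs_le hba'.le ((hφc fun s hs => hb.trans hs.1).mul hf)
      (g := fun _ => φ b * B) intervalIntegrable_const fun s hs => ?_
    have hs' : s ∈ Ioc 0 a₀ := ⟨hb.trans hs.1, hs.2.le⟩
    rw [abs_of_nonneg (mul_nonneg (h.nonneg_s14 hs') (hf0 s hs))]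
    exact mul_le_mul (h.mono b s hb hs.1.le hs.2.le) (hfB s hs) (hf0 s hs)
      (h.nonneg_s14 ⟨hb, hba'.le⟩)
  have hgp : ∀ s ∈ Ioo 0 b, 0 ≤ g (b + s) := fun s hs => hg0 _ (by linarith [hs.1])
  have hgm : ∀ s ∈ Ioo 0 b, 0 ≤ g (b - s) := fun s hs => hg0 _ (by linarith [hs.2])
  have iW₁ : IntervalIntegrable (fun s => φ s * W₁ s) volume 0 b := by
    refine hdom ((continuousOn_const.sub (hωc (by fun_prop) ?_)).sub (hωc (by fun_prop) ?_)) hW₁0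
      fun s hs => by linarith [hG₁ s, hgp s hs, hgm s hs]
    · exact fun s hs => by linarith [hs.1]
    · exact fun s hs => by linarith [hs.2]
  have igp : IntervalIntegrable (fun s => φ s * g (b + s)) volume 0 b :=
    hdom (hgc (by fun_prop) fun s hs => by linarith [hs.1]) hgp
      fun s hs => by linarith [hG₁ s, hW₁0 s hs, hgm s hs]
  have igm : IntervalIntegrable (fun s => φ s * g (b - s)) volume 0 b :=
    hdom (hgc (by fun_prop) fun s hs => by linarith [hs.2]) hgm
      fun s hs => by linarith [hG₁ s, hW₁0 s hs, hgp s hs]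
  have igr : IntervalIntegrable (fun s => φ s * g (b + s)) volume b a₀ := by
    refine ContinuousOn.intervalIntegrable_of_Icc hba'.le ((hφc fun s hs => ?_).mul
      (hgc (by fun_prop) fun s hs => ?_)) <;> linarith [hs.1]
  have iW₂ : IntervalIntegrable (fun s => φ s * W₂ s) volume b a₀ := by
    refine hbdd (B := 2 * ω (2 * b)) ((continuousOn_const.sub (hωc (by fun_prop) ?_)).add
      (hωc (by fun_prop) ?_)) hW₂0 fun s hs => ?_
    · exact fun s hs => by linarith [hs.1]
    · exact fun s hs => by linarith [hs.1]
    · have := hω.mono (a := 2 * (s - b)) (b := 2 * (b + s)) (mem_Ioi.2 (by linarith [hs.1]))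
        (mem_Ioi.2 (by linarith [hs.1])) (by linarith)
      simp only [hW₂def]; linarith
  have igs : IntervalIntegrable (fun s => φ s * g (s - b)) volume b a₀ := by
    refine hbdd (B := 2 * ω (2 * a₀)) (hgc (by fun_prop) fun s hs => by linarith [hs.1])
      (fun s hs => hg0 _ (by linarith [hs.1])) fun s hs => ?_
    have h₁ := hg2 (s - b) (by linarith [hs.1])
    have h₂ := hω.mono (a := 2 * (s - b)) (b := 2 * a₀) (mem_Ioi.2 (by linarith [hs.1]))
      (mem_Ioi.2 (by linarith [h.a₀pos])) (by linarith [hs.2])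
    linarith
  have hrefl := integral_mul_reflection_le hb hba (fun s hs => h.nonneg_s14 hs) h.antitoneOn hg0 igm
    (igp.trans igr) igs
  have hl := h.integral_one_div_mul_div_le le_rfl hb.le hba'.le hW₁0 iW₁
  have hr := h.integral_one_div_mul_div_le hb.le hba'.le le_rfl hW₂0 iW₂
  have el : ∫ s in 0..b, φ s * G s = (∫ s in 0..b, φ s * W₁ s) +
      (∫ s in 0..b, φ s * g (b + s)) + ∫ s in 0..b, φ s * g (b - s) := by
    rw [← intervalIntegral.integral_add iW₁ igp,
      ← intervalIntegral.integral_add (iW₁.add igp) igm]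
    simp only [hG₁, mul_add]
  have er : ∫ s in b..a₀, φ s * G s = (∫ s in b..a₀, φ s * W₂ s) +
      (∫ s in b..a₀, φ s * g (b + s)) - ∫ s in b..a₀, φ s * g (s - b) := by
    rw [← intervalIntegral.integral_add iW₂ igr,
      ← intervalIntegral.integral_sub (iW₂.add igr) igs]
    simp only [hG₂, mul_add, mul_sub]
  rw [← intervalIntegral.integral_add_adjacent_intervals hGl hGr, el, er]
  rw [← intervalIntegral.integral_add_adjacent_intervals igp igr] at hrefl
  linarith

end A12

theorem setIntegral_abs_sub_ge {φ : ℝ → ℝ} (heven : ∀ z, φ (-z) = φ z) (f : ℝ → ℝ) (x ε : ℝ) :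
    ∫ y in {y : ℝ | ε ≤ |x - y|}, φ (x - y) * (f x - f y) =
      ∫ z in {z : ℝ | ε ≤ |z|}, φ z * (f x - f (x + z)) := by
  have := (measurePreserving_add_left volume x).setIntegral_preimage_emb
    (measurableEmbedding_addLeft x) (fun y => φ (x - y) * (f x - f y)) {y : ℝ | ε ≤ |x - y|}
  rw [← this]
  have hset : (fun z => x + z) ⁻¹' {y : ℝ | ε ≤ |x - y|} = {z : ℝ | ε ≤ |z|} := by
    ext z; simp
  rw [hset]
  simp [heven]

/-- (Dissipation lower bound, abstract modulus.) At a breakthrough pair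
`x ≠ y` with `ρ(x) − ρ(y) = ω(ξ)`, `ξ = |x−y| ≤ a₀/2`, one has
`D = 𝓛ρ(x) − 𝓛ρ(y) = p.v.∫ φ(z)(ω(ξ) − ρ(x+z) + ρ(y+z)) dz ≥ D₁ − 2c₂ ω(ξ)` and the
stated integral lower bound for the short-range dissipation `D₁`. -/
theorem stmt14 (φ : ℝ → ℝ) (α a₀ c₁ c₂ : ℝ) (h : A12 φ α a₀ c₁ c₂)
    (ω : ℝ → ℝ) (hω : IsMOC ω)
    (ρ : ℝ → ℝ) (hsm : ContDiff ℝ (⊤ : ℕ∞) ρ) (hper : ∀ x, ρ (x + 1) = ρ x)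
    (hobeys : ∀ a b : ℝ, a ≠ b → |ρ a - ρ b| ≤ ω |a - b|)
    (x y ξ : ℝ) (hxy : x ≠ y) (hξ : ξ = |x - y|) (hξa : ξ ≤ a₀ / 2)
    (hscen : ρ x - ρ y = ω ξ) :
    levy φ ρ x - levy φ ρ y
      = limUnder (nhdsWithin (0:ℝ) (Set.Ioi 0))
          (fun ε => ∫ z in {z : ℝ | ε ≤ |z|}, φ z * (ω ξ - ρ (x + z) + ρ (y + z))) ∧
    levy φ ρ x - levy φ ρ y
      ≥ limUnder (nhdsWithin (0:ℝ) (Set.Ioi 0))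
          (fun ε => ∫ z in {z : ℝ | ε ≤ |z| ∧ |z| ≤ a₀}, φ z * (ω ξ - ρ (x + z) + ρ (y + z)))
        - 2 * c₂ * ω ξ ∧
    limUnder (nhdsWithin (0:ℝ) (Set.Ioi 0))
        (fun ε => ∫ z in {z : ℝ | ε ≤ |z| ∧ |z| ≤ a₀}, φ z * (ω ξ - ρ (x + z) + ρ (y + z)))
      ≥ (1 / c₁) * (∫ η in (0:ℝ)..(ξ/2), (2 * ω ξ - ω (ξ + 2*η) - ω (ξ - 2*η)) / η ^ (1 + α))
        + (1 / c₁) * (∫ η in (ξ/2)..a₀, (2 * ω ξ - ω (2*η + ξ) + ω (2*η - ξ)) / η ^ (1 + α)) := by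
  have hρ : Continuous ρ := hsm.continuous
  have hρ2 : ContDiff ℝ 2 ρ := hsm.of_le (by norm_cast)
  have hξ0 : 0 < ξ := hξ ▸ abs_pos.2 (sub_ne_zero.2 hxy)
  obtain ⟨B, hB⟩ : ∃ B, ∀ z, |ρ z| ≤ B := by
    have hP : Function.Periodic ρ 1 := hper
    obtain ⟨B, hB⟩ := (hP.compact_of_continuous one_ne_zero hρ).exists_bound_of_continuousOn
      continuousOn_id
    exact ⟨B, fun z => hB _ (mem_range_self z)⟩
  obtain ⟨Cx, -, hCx⟩ := hρ2.exists_abs_symm_diff_le x a₀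
  obtain ⟨Cy, -, hCy⟩ := hρ2.exists_abs_symm_diff_le y a₀
  have hbd : ∀ w z, |ρ w - ρ (w + z)| ≤ B + B := fun w z =>
    (abs_sub _ _).trans (add_le_add (hB _) (hB _))
  set F : ℝ → ℝ := fun z => ω ξ - ρ (x + z) + ρ (y + z) with hF
  have hFc : Continuous F := by fun_prop
  have hFb : ∀ z, |F z| ≤ 2 * ω ξ := fun z => by
    have := hobeys (x + z) (y + z) (by simpa using hxy)
    rw [add_sub_add_right_eq_sub, ← hξ] at this
    have := abs_le.1 this
    exact abs_le.2 ⟨by simp only [hF]; linarith, by simp only [hF]; linarith⟩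
  have hFsym : ∀ s ∈ Ioc 0 a₀, |F s + F (-s)| ≤ (Cx + Cy) * s ^ 2 := fun s hs => by
    have h₁ := abs_le.1 (hCx s hs)
    have h₂ := abs_le.1 (hCy s hs)
    simp only [hF, ← sub_eq_add_neg]
    exact abs_le.2 ⟨by linarith [h₁.2, h₂.1], by linarith [h₁.1, h₂.2]⟩
  have hlevy : ∀ w C, (∀ s ∈ Ioc 0 a₀, |ρ (w + s) + ρ (w - s) - 2 * ρ w| ≤ C * s ^ 2) →
      Tendsto (fun ε => ∫ z in {z : ℝ | ε ≤ |z|}, φ z * (ρ w - ρ (w + z))) (𝓝[>] 0)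
        (𝓝 (levy φ ρ w)) := fun w C hC => by
    have hc : Continuous fun z => ρ w - ρ (w + z) := by fun_prop
    have ht := tendsto_setIntegral_abs_ge h.a₀pos (h.continuousOn_mul hc)
      (h.tail_integrable_mul hc (hbd w)) (h.intervalIntegrable_symm hc (C := C) fun s hs => by
        rw [← abs_neg, ← sub_eq_add_neg]
        convert hC s hs using 2
        ring)
    simp only [levy, setIntegral_abs_sub_ge h.even]
    exact tendsto_nhds_limUnder ⟨_, ht⟩
  have hFi := h.intervalIntegrable_symm hFc hFsym
  have hD := tendsto_setIntegral_abs_ge h.a₀pos (h.continuousOn_mul hFc)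
    (h.tail_integrable_mul hFc hFb) hFi
  have hD₁ := tendsto_setIntegral_annulus h.a₀pos (h.continuousOn_mul hFc) hFi
  have hdiff : Tendsto (fun ε => ∫ z in {z : ℝ | ε ≤ |z|}, φ z * F z) (𝓝[>] 0)
      (𝓝 (levy φ ρ x - levy φ ρ y)) := by
    refine ((hlevy x Cx hCx).sub (hlevy y Cy hCy)).congr' ?_
    filter_upwards [self_mem_nhdsWithin] with ε hε
    have hint : ∀ w, IntegrableOn (fun z => φ z * (ρ w - ρ (w + z))) {z : ℝ | ε ≤ |z|} := fun w =>
      have hc : Continuous fun z => ρ w - ρ (w + z) := by fun_prop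
      integrableOn_abs_ge hε (h.continuousOn_mul hc) (h.tail_integrable_mul hc (hbd w))
    rw [← integral_sub (hint x) (hint y)]
    refine integral_congr_ae (Eventually.of_forall fun z => ?_)
    simp only [hF, ← hscen]
    ring
  have hlev := tendsto_nhds_unique hdiff hD
  rw [hD₁.limUnder_eq]
  refine ⟨hdiff.limUnder_eq.symm, ?_, ?_⟩
  · have htail : |∫ z in {z : ℝ | a₀ < |z|}, φ z * F z| ≤ 2 * c₂ * ω ξ := by
      calc |∫ z in {z : ℝ | a₀ < |z|}, φ z * F z|
          ≤ ∫ z in {z : ℝ | a₀ < |z|}, |φ z| * (2 * ω ξ) := by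
            rw [← Real.norm_eq_abs]
            refine norm_integral_le_of_norm_le (h.tail_integrable.abs.mul_const _)
              (Eventually.of_forall fun z => ?_)
            rw [norm_mul]
            exact mul_le_mul_of_nonneg_left (hFb z) (norm_nonneg _)
        _ = (∫ z in {z : ℝ | a₀ < |z|}, |φ z|) * (2 * ω ξ) := integral_mul_const _ _
        _ ≤ c₂ * (2 * ω ξ) :=
            mul_le_mul_of_nonneg_right h.tail_bound (by linarith [hω.pos ξ hξ0])
        _ = 2 * c₂ * ω ξ := by ring
    linarith [(abs_le.1 htail).1]
  · have key : ∀ σ : ℝ, |σ| = 1 → x - y = σ * ξ →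
        (1 / c₁) * (∫ η in (0:ℝ)..(ξ/2),
            (2 * ω ξ - ω (ξ + 2*η) - ω (ξ - 2*η)) / η ^ (1 + α)) +
          (1 / c₁) * (∫ η in (ξ/2)..a₀,
            (2 * ω ξ - ω (2*η + ξ) + ω (2*η - ξ)) / η ^ (1 + α)) ≤
        ∫ z in 0..a₀, (φ z * F z + φ (-z) * F (-z)) := by
      intro σ hσ hxyσ
      have hσ' : σ = 1 ∨ σ = -1 := eq_or_eq_neg_of_abs_eq hσ
      have hsymm : ∀ s, φ s * F s + φ (-s) * F (-s) = φ s * (2 * ω (2 * (ξ / 2)) -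
          ρ ((x + y) / 2 + σ * (ξ / 2 + s)) - ρ ((x + y) / 2 + σ * (ξ / 2 - s)) +
          ρ ((x + y) / 2 + σ * (-(ξ / 2 - s))) + ρ ((x + y) / 2 + σ * (-(ξ / 2 + s)))) := by
        intro s
        have ex : x = (x + y) / 2 + σ * (ξ / 2) := by linarith
        have ey : y = (x + y) / 2 - σ * (ξ / 2) := by linarith
        rw [h.even, show 2 * (ξ / 2) = ξ by ring]
        generalize (x + y) / 2 = c at ex ey
        simp only [hF, ex, ey]
        rcases hσ' with rfl | rfl <;> ring_nf
      simp only [hsymm] at hFi ⊢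
      have := h.short_range_lower_bound hω (p := fun t => ρ ((x + y) / 2 + σ * t)) (by fun_prop)
        (fun t ht => by
          have hσ0 : σ ≠ 0 := fun h0 => by simp [h0] at hσ
          have hne : (x + y) / 2 + σ * t ≠ (x + y) / 2 + σ * (-t) := fun he => by
            have := mul_left_cancel₀ hσ0 (add_left_cancel he)
            linarith
          have hobt := hobeys _ _ hne
          rwa [show (x + y) / 2 + σ * t - ((x + y) / 2 + σ * (-t)) = σ * (2 * t) by ring, abs_mul,
            hσ, one_mul, abs_of_pos (by linarith : 0 < 2 * t)] at hobt)
        (half_pos hξ0) (by linarith [h.a₀pos]) hFi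
      convert this using 10 <;> ring_nf
    rcases abs_choice (x - y) with hc | hc
    · exact key 1 (by norm_num) (by linarith)
    · exact key (-1) (by norm_num) (by linarith)
end
end
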